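/- arXiv:2603.28299 — 3 statements merged into one kernel-verified Lean document; each statement's English description precedes it below -/
import Mathlib

section
/- Let 0<α<1, a<b, T>0, and let f be continuous and bounded on [a,b]×[0,T]. Then for every x with a<x<b and every 0<t≤T, lim_{η→t⁻} ∫_a^b G_α^{1−α/3}(x−ξ, t−η) f(ξ,η) dξ = f(x,t). -/
open MeasureTheory Real Filter Set Topology

/-- Caputo fractional derivative of order `α` with base point `0`. -/
noncomputable def caputoD (α : ℝ) (g : ℝ → ℝ) (t : ℝ) : ℝ :=
  (1 / Real.Gamma (1 - α)) * ∫ ξ in (0:ℝ)..t, deriv g ξ / (t - ξ) ^ α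

/-- Riemann–Liouville fractional integral of order `β` with base point `0`. -/
noncomputable def fracJ (β : ℝ) (g : ℝ → ℝ) (t : ℝ) : ℝ :=
  (1 / Real.Gamma β) * ∫ ξ in (0:ℝ)..t, g ξ * (t - ξ) ^ (β - 1)

/-- The Wright function `φ(λ, μ; z)`. -/
noncomputable def wrightPhi (l μ z : ℂ) : ℂ :=
  ∑' n : ℕ, z ^ n / ((n.factorial : ℂ) * Complex.Gamma (l * n + μ))

/-- The cube root of unity `e^{2πi/3}`. -/
noncomputable def e23 : ℂ := Complex.exp (2 * Real.pi * Complex.I / 3)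

/-- First fundamental solution `G_α^μ(x,t)` of the time-fractional Airy equation. -/
noncomputable def Gfun (α μ : ℝ) (x t : ℝ) : ℝ :=
  if x < 0 then
    (1/3) * t ^ (μ - 1) * (wrightPhi (-(α/3)) μ ((x / t ^ (α/3) : ℝ) : ℂ)).re
  else
    -(2/3) * t ^ (μ - 1) * (e23 * wrightPhi (-(α/3)) μ (e23 * ((x / t ^ (α/3) : ℝ) : ℂ))).re

/-- Second fundamental solution `V_α^μ(x,t)` of the time-fractional Airy equation. -/
noncomputable def Vfun (α μ : ℝ) (x t : ℝ) : ℝ :=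
  (1/3) * t ^ (μ - 1) * (e23 * wrightPhi (-(α/3)) μ (e23 * ((x / t ^ (α/3) : ℝ) : ℂ))).im

/-- `G_α^μ` extended across `x = 0` by its common one-sided limit. -/
noncomputable def Ghat (α μ : ℝ) (x t : ℝ) : ℝ :=
  if x = 0 then t ^ (μ - 1) / (3 * Real.Gamma μ) else Gfun α μ x t

namespace WK

theorem integrable_aux {q c : ℝ} (hq : 0 ≤ q) (hc : 0 < c) :
    IntegrableOn (fun r : ℝ => r ^ q * Real.exp (-(c * r))) (Ioi 0) := by
  have := integrableOn_rpow_mul_exp_neg_mul_rpow (p := 1) (s := q) (b := c) (by linarith) one_pos hc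
  simpa using this

theorem gamma_rot {q : ℝ} (hq : 0 ≤ q) {c : ℂ} (hc : 0 < c.re) :
    ∫ r in Ioi (0:ℝ), ((r ^ q : ℝ) : ℂ) * Complex.exp (-(c * r)) =
      c ^ (-((q:ℂ) + 1)) * (Real.Gamma (q + 1) : ℂ) := by
  set ν : Measure ℝ := (volume.restrict (Ioi 0)).withDensity (fun r => ENNReal.ofReal (r ^ q)) with hν
  have hmeas : Measurable (fun r : ℝ => ENNReal.ofReal (r ^ q)) := by fun_prop
  have hlt : ∀ᵐ r ∂(volume.restrict (Ioi (0:ℝ))), ENNReal.ofReal (r ^ q) < ⊤ := by simp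
  have hset : Iio 0 ⊆ ProbabilityTheory.integrableExpSet id ν := by
    intro t ht
    have ht' : t < 0 := ht
    change Integrable (fun ω => Real.exp (t * id ω)) ν
    rw [hν, integrable_withDensity_iff hmeas hlt]
    have := integrable_aux hq (c := -t) (by linarith)
    refine (this.congr_fun ?_ measurableSet_Ioi)
    intro r hr
    have hr' : 0 ≤ r := le_of_lt hr
    simp [ENNReal.toReal_ofReal (Real.rpow_nonneg hr' q), mul_comm]
  have hval : ∀ z : ℂ, ProbabilityTheory.complexMGF id ν z =
      ∫ r in Ioi (0:ℝ), ((r ^ q : ℝ) : ℂ) * Complex.exp (z * r) := by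
    intro z
    rw [ProbabilityTheory.complexMGF, hν, integral_withDensity_eq_integral_toReal_smul hmeas hlt]
    refine setIntegral_congr_fun measurableSet_Ioi ?_
    intro r hr
    have hr' : 0 ≤ r := le_of_lt hr
    simp [ENNReal.toReal_ofReal (Real.rpow_nonneg hr' q)]
  have hF : AnalyticOnNhd ℂ (ProbabilityTheory.complexMGF id ν) {z | z.re < 0} := by
    refine ProbabilityTheory.analyticOnNhd_complexMGF.mono ?_
    intro z hz
    exact interior_maximal hset isOpen_Iio hz
  have hG : AnalyticOnNhd ℂ (fun z : ℂ => (-z) ^ (-((q:ℂ) + 1)) * (Real.Gamma (q + 1) : ℂ)) {z | z.re < 0} := by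
    refine DifferentiableOn.analyticOnNhd ?_ (isOpen_lt Complex.continuous_re continuous_const)
    intro z hz
    have hz' : z.re < 0 := hz
    refine DifferentiableAt.differentiableWithinAt ?_
    refine DifferentiableAt.mul_const ?_ _
    refine DifferentiableAt.cpow_const (by fun_prop) ?_
    left; simpa using hz'
  have hpre : IsPreconnected {z : ℂ | z.re < 0} :=
    (convex_halfSpace_re_lt 0).isPreconnected
  have hreal : ∀ t : ℝ, t < 0 → ProbabilityTheory.complexMGF id ν t =
      (-(t:ℂ)) ^ (-((q:ℂ) + 1)) * (Real.Gamma (q + 1) : ℂ) := by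
    intro t ht
    rw [hval]
    have h1 := Real.integral_rpow_mul_exp_neg_mul_Ioi (a := q + 1) (r := -t) (by linarith) (by linarith)
    have h2 : (-(t:ℂ)) ^ (-((q:ℂ) + 1)) = (((1 / (-t)) ^ (q + 1) : ℝ) : ℂ) := by
      rw [one_div, Real.inv_rpow (by linarith), ← Real.rpow_neg (by linarith),
        Complex.ofReal_cpow (by linarith)]
      push_cast; rfl
    rw [h2, ← Complex.ofReal_mul, ← h1, ← integral_complex_ofReal]
    refine integral_congr_ae (Eventually.of_forall fun r => ?_)
    simp
  have key := hF.eqOn_of_preconnected_of_frequently_eq hG hpre (z₀ := -1) (by simp) ?_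
  · have := key (x := -c) (by simpa using hc)
    rw [hval] at this
    simpa using this
  · rw [frequently_iff]
    intro U hU
    have hcont : Tendsto (fun n : ℕ => (((-1 - 1 / ((n:ℝ) + 1) : ℝ)) : ℂ)) atTop (𝓝[≠] (-1)) := by
      refine tendsto_nhdsWithin_iff.2 ⟨?_, Eventually.of_forall fun n => ?_⟩
      · have := (tendsto_const_nhds (x := (-1:ℝ))).sub tendsto_one_div_add_atTop_nhds_zero_nat
        have h2 := (Complex.continuous_ofReal.tendsto _).comp this
        simpa [Function.comp_def] using h2
      · intro h
        have h' := congrArg Complex.re h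
        rw [Complex.ofReal_re] at h'
        have : (0:ℝ) < 1 / ((n:ℝ) + 1) := by positivity
        simp only [Complex.neg_re, Complex.one_re] at h'
        linarith
    obtain ⟨n, hn⟩ := (hcont.eventually hU).exists
    refine ⟨_, hn, hreal _ ?_⟩
    have : (0:ℝ) < 1 / ((n:ℝ) + 1) := by positivity
    linarith

/-- Coefficients `Γ(1+βn)/n!`. -/
noncomputable def ec (β : ℝ) (n : ℕ) : ℝ := Real.Gamma (β * n + 1) / n.factorial

theorem ec_nonneg {β : ℝ} (hβ : 0 < β) (n : ℕ) : 0 ≤ ec β n := by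
  unfold ec; positivity

theorem ec_le {β : ℝ} (hβ : 0 < β) (hβ1 : β < 1) (n : ℕ) :
    ec β n ≤ ((n.factorial : ℝ)) ^ (β - 1) := by
  have h := Real.Gamma_mul_add_mul_le_rpow_Gamma_mul_rpow_Gamma (s := (n:ℝ) + 1) (t := 1) (a := β)
    (b := 1 - β) (by positivity) one_pos hβ (by linarith) (by ring)
  rw [Real.Gamma_one, Real.one_rpow, mul_one, Real.Gamma_nat_eq_factorial] at h
  have hpos : (0:ℝ) < n.factorial := by positivity
  rw [ec, Real.rpow_sub hpos, Real.rpow_one]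
  have : β * (n:ℝ) + 1 = β * (n + 1) + (1 - β) * 1 := by ring
  rw [this]
  gcongr
  simpa using h

theorem summable_ec {β : ℝ} (hβ : 0 < β) (hβ1 : β < 1) {R : ℝ} (hR : 0 ≤ R) :
    Summable (fun n => ec β n * R ^ n) := by
  have hs : Summable (fun n : ℕ => ((n.factorial : ℝ)) ^ (β - 1) * (R + 1) ^ n) := by
    refine summable_of_ratio_test_tendsto_lt_one (l := 0) one_pos (Eventually.of_forall fun n => ?_) ?_
    · positivity
    · have : Tendsto (fun n : ℕ => ((n:ℝ) + 1) ^ (-(1 - β)) * (R + 1)) atTop (𝓝 (0 * (R + 1))) := by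
        refine Tendsto.mul_const _ ?_
        exact (tendsto_rpow_neg_atTop (by linarith)).comp
          (tendsto_atTop_add_const_right _ _ tendsto_natCast_atTop_atTop)
      rw [zero_mul] at this
      refine this.congr fun n => ?_
      have h1 : (0:ℝ) < n.factorial := by positivity
      have h2 : (0:ℝ) < (R + 1) ^ n := by positivity
      rw [Real.norm_of_nonneg (by positivity), Real.norm_of_nonneg (by positivity),
        Nat.factorial_succ, Nat.cast_mul, Real.mul_rpow (by positivity) (by positivity), pow_succ]
      have h3 : (0:ℝ) < (n.factorial:ℝ) ^ (β - 1) := by positivity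
      push_cast
      rw [show -(1 - β) = β - 1 by ring]
      field_simp
  refine Summable.of_nonneg_of_le (fun n => ?_) (fun n => ?_) hs
  · have := ec_nonneg hβ n; positivity
  · have := ec_le hβ hβ1 n
    gcongr
    linarith

/-- The entire function `E(z) = Σ Γ(1+βn) z^n/n!`. -/
noncomputable def EE (β : ℝ) (z : ℂ) : ℂ := ∑' n : ℕ, (ec β n : ℂ) * z ^ n

theorem summable_norm_EE {β : ℝ} (hβ : 0 < β) (hβ1 : β < 1) (z : ℂ) :
    Summable (fun n : ℕ => ‖(ec β n : ℂ) * z ^ n‖) := by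
  refine (summable_ec hβ hβ1 (norm_nonneg z)).congr fun n => ?_
  rw [norm_mul, norm_pow, Complex.norm_real, Real.norm_of_nonneg (ec_nonneg hβ n)]

theorem EE_integral {β : ℝ} (hβ : 0 < β) (hβ1 : β < 1) {δ : ℝ} (hδ : |δ| < π / 2) (z : ℂ) :
    EE β z = Complex.exp (δ * Complex.I) * ∫ r in Ioi (0:ℝ),
      Complex.exp (-(Complex.exp (δ * Complex.I) * r)) *
        Complex.exp (z * Complex.exp (β * δ * Complex.I) * ((r ^ β : ℝ) : ℂ)) := by
  set c := Complex.exp (δ * Complex.I) with hc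
  set w := z * Complex.exp (β * δ * Complex.I) with hw
  have hcre : c.re = Real.cos δ := by rw [hc, Complex.exp_ofReal_mul_I_re]
  have hcos : 0 < Real.cos δ := Real.cos_pos_of_mem_Ioo (abs_lt.1 hδ |>.imp (by intro h; linarith) id)
  let F : ℕ → ℝ → ℂ := fun n r => w ^ n / n.factorial * (((r ^ (β * n) : ℝ) : ℂ) * Complex.exp (-(c * r)))
  have hnorm : ∀ n r, 0 < r → ‖F n r‖ = ‖w‖ ^ n / n.factorial * (r ^ (β * n) * Real.exp (-(Real.cos δ * r))) := by
    intro n r hr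
    simp only [F, norm_mul, norm_div, norm_pow, Complex.norm_natCast, Complex.norm_real,
      Complex.norm_exp]
    rw [Real.norm_of_nonneg (by positivity)]
    simp [hcre]
  have hqn : ∀ n : ℕ, 0 ≤ β * n := fun n => by positivity
  have hint : ∀ n, Integrable (F n) (volume.restrict (Ioi 0)) := by
    intro n
    have h1 := (integrable_aux (hqn n) hcos).const_mul (‖w‖ ^ n / n.factorial)
    refine Integrable.mono' h1 (by fun_prop) ?_
    filter_upwards [ae_restrict_mem measurableSet_Ioi] with r hr
    rw [hnorm n r hr]
  have hsum : Summable (fun n => ∫ r in Ioi (0:ℝ), ‖F n r‖) := by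
    have hs := (summable_ec hβ hβ1 (R := ‖w‖ * (1 / Real.cos δ) ^ β) (by positivity)).mul_left (1 / Real.cos δ)
    refine hs.congr fun n => ?_
    rw [setIntegral_congr_fun measurableSet_Ioi (fun r hr => hnorm n r hr), integral_const_mul]
    have := Real.integral_rpow_mul_exp_neg_mul_Ioi (a := β * n + 1) (r := Real.cos δ) (by positivity) hcos
    rw [add_sub_cancel_right] at this
    rw [this, ec, Real.rpow_add (by positivity), Real.rpow_mul (by positivity), Real.rpow_one,
      Real.rpow_natCast, mul_pow]
    ring
  have hh := hasSum_integral_of_summable_integral_norm hint hsum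
  have hE : ∀ r ∈ Ioi (0:ℝ), ∑' n, F n r = Complex.exp (-(c * r)) * Complex.exp (w * ((r ^ β : ℝ) : ℂ)) := by
    intro r hr
    have hr' : 0 ≤ r := le_of_lt hr
    have hx : Complex.exp (w * ((r ^ β : ℝ) : ℂ)) = ∑' n : ℕ, (w * ((r ^ β : ℝ) : ℂ)) ^ n / n.factorial := by
      rw [Complex.exp_eq_exp_ℂ, NormedSpace.exp_eq_tsum_div]
    rw [hx, ← tsum_mul_left]
    refine tsum_congr fun n => ?_
    simp only [F]
    rw [Real.rpow_mul hr', Real.rpow_natCast, mul_pow w]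
    push_cast
    ring
  rw [setIntegral_congr_fun measurableSet_Ioi hE] at hh
  rw [← hh.tsum_eq, ← tsum_mul_left, EE]
  refine tsum_congr fun n => ?_
  simp only [F]
  rw [integral_const_mul, gamma_rot (hqn n) (by rw [hcre]; exact hcos)]
  have hpi : -π < δ ∧ δ ≤ π := by
    have := abs_lt.1 hδ
    constructor <;> linarith [Real.pi_pos]
  have hlog : Complex.log c = δ * Complex.I := by
    rw [hc, Complex.log_exp] <;> simp [hpi.1, hpi.2]
  have hc0 : c ≠ 0 := Complex.exp_ne_zero _
  rw [Complex.cpow_def_of_ne_zero hc0, hlog, hw, mul_pow, ← Complex.exp_nat_mul, ec]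
  have : Complex.exp (δ * Complex.I * -(((β * n : ℝ) : ℂ) + 1)) * (c * Complex.exp (n * (β * δ * Complex.I))) = 1 := by
    rw [hc, ← Complex.exp_add, ← Complex.exp_add, Complex.exp_eq_one_iff]
    refine ⟨0, ?_⟩
    push_cast; ring
  push_cast at this ⊢
  linear_combination (-(Real.Gamma (β * n + 1) : ℂ) * z ^ n / n.factorial) * this

theorem EE_bound {β : ℝ} (hβ : 0 < β) (hβ1 : β < 1) {δ : ℝ} (hδ : |δ| < π / 2) {z : ℂ} {k : ℝ}
    (hk : 0 < k) (hz : (z * Complex.exp (β * δ * Complex.I)).re ≤ -k) :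
    ‖EE β z‖ ≤ k ^ (-1 / β) * Real.Gamma (1 / β + 1) := by
  rw [EE_integral hβ hβ1 hδ z, norm_mul, Complex.norm_exp_ofReal_mul_I, one_mul,
    ← integral_exp_neg_mul_rpow hβ hk]
  have hcos : 0 < Real.cos δ := Real.cos_pos_of_mem_Ioo (abs_lt.1 hδ |>.imp (by intro h; linarith) id)
  refine norm_integral_le_of_norm_le ?_ ?_
  · have := integrableOn_rpow_mul_exp_neg_mul_rpow (s := 0) (by norm_num) hβ hk
    simpa [IntegrableOn] using this
  · filter_upwards [ae_restrict_mem measurableSet_Ioi] with r hr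
    have hr' : 0 < r := hr
    have hrp : 0 < r ^ β := Real.rpow_pos_of_pos hr' _
    rw [norm_mul, Complex.norm_exp, Complex.norm_exp, ← Real.exp_add, Real.exp_le_exp]
    rw [Complex.re_mul_ofReal, Complex.neg_re, Complex.re_mul_ofReal, Complex.exp_ofReal_mul_I_re]
    nlinarith

end WK

namespace WK

/-- Real coefficients of the Wright function. -/
noncomputable def ac (β : ℝ) (n : ℕ) : ℝ := ec β (n + 1) * Real.sin (π * (β * (n + 1))) / (π * β)

theorem coef_eq {β : ℝ} (hβ : 0 < β) (n : ℕ) :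
    1 / ((n.factorial : ℂ) * Complex.Gamma (-(β:ℂ) * n + ((1 - β : ℝ) : ℂ))) = (ac β n : ℂ) := by
  have hw : (0:ℝ) < β * (n + 1) := by positivity
  have harg : -(β:ℂ) * n + ((1 - β : ℝ) : ℂ) = ((1 - β * (n + 1) : ℝ) : ℂ) := by push_cast; ring
  rw [harg, Complex.Gamma_ofReal]
  have hr := Real.Gamma_mul_Gamma_one_sub (β * (n + 1))
  have hG : 0 < Real.Gamma (β * (n + 1)) := Real.Gamma_pos_of_pos hw
  have key : 1 / ((n.factorial : ℝ) * Real.Gamma (1 - β * (n + 1))) = ac β n := by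
    rw [ac, ec]
    push_cast
    rw [Real.Gamma_add_one hw.ne', Nat.factorial_succ]
    have hf : (0:ℝ) < n.factorial := by positivity
    have hπ := Real.pi_pos
    by_cases hs : Real.sin (π * (β * (n + 1))) = 0
    · rw [hs, div_zero] at hr
      have : Real.Gamma (1 - β * (n + 1)) = 0 := by
        rcases mul_eq_zero.1 hr with h | h
        · exact absurd h hG.ne'
        · exact h
      rw [this, hs]; simp
    · have : Real.Gamma (1 - β * (n + 1)) = π / Real.sin (π * (β * (n + 1))) / Real.Gamma (β * (n + 1)) := by
        rw [← hr]; field_simp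
      rw [this]
      push_cast
      field_simp
  rw [← key]; push_cast; rfl

/-- The Wright function `φ(-β, 1-β; z)`. -/
noncomputable def ph (β : ℝ) (z : ℂ) : ℂ := ∑' n : ℕ, (ac β n : ℂ) * z ^ n

theorem wright_eq {β : ℝ} (hβ : 0 < β) (z : ℂ) :
    wrightPhi (-(β:ℂ)) ((1 - β : ℝ) : ℂ) z = ph β z := by
  rw [wrightPhi, ph]
  refine tsum_congr fun n => ?_
  rw [← coef_eq hβ]; ring

theorem ac_abs_le {β : ℝ} (hβ : 0 < β) (n : ℕ) : |ac β n| ≤ ec β (n + 1) / (π * β) := by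
  have h1 := ec_nonneg hβ (n + 1)
  have hπ := Real.pi_pos
  rw [ac, abs_div, abs_mul, abs_of_nonneg h1, abs_of_pos (by positivity : 0 < π * β)]
  gcongr
  exact mul_le_of_le_one_right h1 (Real.abs_sin_le_one _)

theorem summable_ac {β : ℝ} (hβ : 0 < β) (hβ1 : β < 1) {R : ℝ} (hR : 0 ≤ R) :
    Summable (fun n => |ac β n| * R ^ n) := by
  have h := ((summable_nat_add_iff 1).2 (summable_ec hβ hβ1 (R := R + 1) (by linarith))).mul_left (1 / (π * β))
  refine Summable.of_nonneg_of_le (fun n => by positivity) (fun n => ?_) h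
  have h1 := ac_abs_le hβ n
  have h2 : R ^ n ≤ (R + 1) ^ (n + 1) := by
    calc R ^ n ≤ (R + 1) ^ n := by gcongr; linarith
      _ ≤ (R + 1) ^ (n + 1) := pow_le_pow_right₀ (by linarith) (by omega)
  have h3 := ec_nonneg hβ (n + 1)
  have hπ := Real.pi_pos
  calc |ac β n| * R ^ n ≤ (ec β (n + 1) / (π * β)) * (R + 1) ^ (n + 1) := by gcongr
    _ = _ := by ring

theorem ph_continuous {β : ℝ} (hβ : 0 < β) (hβ1 : β < 1) : Continuous (ph β) := by
  rw [continuous_iff_continuousAt]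
  intro z
  have : ContinuousOn (ph β) (Metric.ball 0 (‖z‖ + 1)) := by
    refine continuousOn_tsum (u := fun n => |ac β n| * (‖z‖ + 1) ^ n) (fun n => by fun_prop)
      (summable_ac hβ hβ1 (by positivity)) ?_
    intro n x hx
    rw [norm_mul, norm_pow, Complex.norm_real, Real.norm_eq_abs]
    have : ‖x‖ ≤ ‖z‖ + 1 := by simpa using (mem_ball_zero_iff.1 hx).le
    gcongr
  exact this.continuousAt (Metric.isOpen_ball.mem_nhds (by simp))

theorem mul_ph {β : ℝ} (hβ : 0 < β) (hβ1 : β < 1) (z : ℂ) :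
    2 * π * β * Complex.I * (z * ph β z) = EE β (z * Complex.exp (π * β * Complex.I))
      - EE β (z * Complex.exp (-(π * β * Complex.I))) := by
  rw [EE, EE, ← (summable_norm_EE hβ hβ1 _).of_norm.tsum_sub (summable_norm_EE hβ hβ1 _).of_norm,
    Summable.tsum_eq_zero_add
      ((summable_norm_EE hβ hβ1 _).of_norm.sub (summable_norm_EE hβ hβ1 _).of_norm), ph,
    ← tsum_mul_left, ← tsum_mul_left]
  simp only [pow_zero, sub_self, zero_add]
  refine tsum_congr fun n => ?_
  rw [mul_pow, mul_pow, ← Complex.exp_nat_mul, ← Complex.exp_nat_mul, ac]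
  have hs := Complex.two_sin (π * (β * (n + 1)))
  have hπ : (π : ℂ) ≠ 0 := by exact_mod_cast Real.pi_ne_zero
  have hβ' : (β : ℂ) ≠ 0 := by exact_mod_cast hβ.ne'
  have e1 : Complex.exp (((n + 1 : ℕ) : ℂ) * (π * β * Complex.I)) = Complex.exp ((π * (β * (n + 1))) * Complex.I) := by
    congr 1; push_cast; ring
  have e2 : Complex.exp (((n + 1 : ℕ) : ℂ) * -(π * β * Complex.I)) = Complex.exp (-(π * (β * (n + 1))) * Complex.I) := by
    congr 1; push_cast; ring
  rw [e1, e2]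
  have hI : Complex.I ^ 2 = -1 := Complex.I_sq
  have : Complex.exp ((π * (β * (n + 1))) * Complex.I) - Complex.exp (-(π * (β * (n + 1))) * Complex.I)
     = 2 * Complex.I * Complex.sin (π * (β * (n + 1))) := by
    linear_combination (-Complex.I) * hs + (Complex.exp ((π * (β * (n + 1))) * Complex.I) - Complex.exp (-(π * (β * (n + 1))) * Complex.I)) * hI
  have hcan : (π : ℂ) * β * ((ec β (n + 1) : ℂ) * Complex.sin (π * (β * (n + 1))) / (π * β)) =
      (ec β (n + 1) : ℂ) * Complex.sin (π * (β * (n + 1))) := mul_div_cancel₀ _ (mul_ne_zero hπ hβ')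
  push_cast
  linear_combination (2 * Complex.I * z ^ (n + 1)) * hcan - ((ec β (n + 1) : ℂ) * z ^ (n + 1)) * this

/-- Good rays: rotated decay condition. -/
def Good (β : ℝ) (ρ : ℂ) (δ k : ℝ) : Prop :=
  ‖ρ‖ = 1 ∧ |δ| < π / 2 ∧ 0 < k ∧ ∀ θ ∈ Set.Icc (-1:ℝ) 1,
    (ρ * Complex.exp (θ * (π * β * Complex.I)) * Complex.exp (β * δ * Complex.I)).re ≤ -k

theorem good_EE {β : ℝ} (hβ : 0 < β) (hβ1 : β < 1) {ρ : ℂ} {δ k : ℝ} (hg : Good β ρ δ k)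
    {θ : ℝ} (hθ : θ ∈ Set.Icc (-1:ℝ) 1) {s : ℝ} (hs : 0 < s) :
    ‖EE β (ρ * s * Complex.exp (θ * (π * β * Complex.I)))‖ ≤
      s ^ (-1 / β) * (k ^ (-1 / β) * Real.Gamma (1 / β + 1)) := by
  obtain ⟨-, hδ, hk, h⟩ := hg
  rw [← mul_assoc (s ^ (-1 / β)), ← Real.mul_rpow hs.le hk.le]
  refine EE_bound hβ hβ1 hδ (by positivity) ?_
  have : ρ * s * Complex.exp (θ * (π * β * Complex.I)) * Complex.exp (β * δ * Complex.I)
    = (s : ℂ) * (ρ * Complex.exp (θ * (π * β * Complex.I)) * Complex.exp (β * δ * Complex.I)) := by ring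
  rw [this, Complex.re_ofReal_mul]
  have := h θ hθ
  nlinarith

theorem good_ph {β : ℝ} (hβ : 0 < β) (hβ1 : β < 1) {ρ : ℂ} {δ k : ℝ} (hg : Good β ρ δ k) :
    ∃ C, ∀ s : ℝ, 0 < s → ‖ph β (ρ * s)‖ ≤ C * s ^ (-1 / β - 1) := by
  set D := k ^ (-1 / β) * Real.Gamma (1 / β + 1) with hD
  refine ⟨D / (π * β), fun s hs => ?_⟩
  have h1 := good_EE hβ hβ1 hg (θ := 1) (by simp) hs
  have h2 := good_EE hβ hβ1 hg (θ := -1) (by simp) hs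
  have h3 := mul_ph hβ hβ1 (ρ * s)
  have e1 : ((1:ℝ):ℂ) * (π * β * Complex.I) = π * β * Complex.I := by simp
  have e2 : ((-1:ℝ):ℂ) * (π * β * Complex.I) = -(π * β * Complex.I) := by simp
  rw [e1] at h1
  rw [e2] at h2
  have h4 := congrArg norm h3
  have h5 := norm_sub_le (EE β (ρ * s * Complex.exp (π * β * Complex.I))) (EE β (ρ * s * Complex.exp (-(π * β * Complex.I))))
  rw [← h4] at h5
  simp only [norm_mul, Complex.norm_real, Complex.norm_I, hg.1, Complex.norm_ofNat, mul_one, one_mul,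
    Real.norm_of_nonneg hs.le, Real.norm_of_nonneg hβ.le, Real.norm_of_nonneg Real.pi_pos.le] at h5
  rw [Real.rpow_sub hs, Real.rpow_one]
  have hπ := Real.pi_pos
  rw [div_mul_div_comm, le_div_iff₀ (by positivity)]
  rw [← hD] at h1 h2
  nlinarith

theorem ph_integrable {β : ℝ} (hβ : 0 < β) (hβ1 : β < 1) {ρ : ℂ} {δ k : ℝ} (hg : Good β ρ δ k) :
    IntegrableOn (fun s : ℝ => ph β (ρ * s)) (Ioi 0) := by
  obtain ⟨C, hC⟩ := good_ph hβ hβ1 hg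
  have hcont : Continuous (fun s : ℝ => ph β (ρ * s)) := (ph_continuous hβ hβ1).comp (by fun_prop)
  rw [← Ioc_union_Ioi_eq_Ioi (zero_le_one (α := ℝ))]
  refine IntegrableOn.union ((hcont.integrableOn_Icc (a := 0) (b := 1)).mono_set Ioc_subset_Icc_self) ?_
  have h1 : IntegrableOn (fun s : ℝ => s ^ (-1 / β - 1)) (Ioi 1) := by
    refine integrableOn_Ioi_rpow_of_lt ?_ one_pos
    have : -1 / β < 0 := div_neg_of_neg_of_pos (by norm_num) hβ
    linarith
  refine Integrable.mono' (h1.const_mul C) hcont.aestronglyMeasurable ?_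
  filter_upwards [ae_restrict_mem measurableSet_Ioi] with s hs
  exact hC s (lt_trans one_pos hs)

theorem int_ph {β : ℝ} (hβ : 0 < β) (hβ1 : β < 1) {ρ : ℂ} (hρ : ‖ρ‖ = 1) {X : ℝ} (hX : 0 < X) :
    HasSum (fun n : ℕ => (ac β n : ℂ) * (ρ * X) ^ (n + 1) / (n + 1)) (∫ s in (0:ℝ)..X, ρ * ph β (ρ * s)) := by
  have := intervalIntegral.hasSum_integral_of_dominated_convergence (μ := volume) (a := 0) (b := X)
    (F := fun (n : ℕ) (s : ℝ) => ρ * ((ac β n : ℂ) * (ρ * s) ^ n)) (f := fun s => ρ * ph β (ρ * s))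
    (fun n _ => |ac β n| * X ^ n) (fun n => by fun_prop) ?_ ?_ ?_ ?_
  · have hfun : (fun n : ℕ => (ac β n : ℂ) * (ρ * X) ^ (n + 1) / (n + 1)) =
        fun n : ℕ => ∫ s in (0:ℝ)..X, ρ * ((ac β n : ℂ) * (ρ * s) ^ n) := by
      funext n
      have e : ∀ s : ℝ, ρ * ((ac β n : ℂ) * (ρ * s) ^ n) = (ρ ^ (n + 1) * ac β n) * ((s ^ n : ℝ) : ℂ) := by
        intro s; push_cast; ring
      simp_rw [e]
      rw [intervalIntegral.integral_const_mul, intervalIntegral.integral_ofReal, integral_pow]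
      push_cast
      ring
    rw [hfun]
    exact this
  · intro n
    refine Eventually.of_forall fun s hs => ?_
    rw [uIoc_of_le hX.le] at hs
    rw [norm_mul, norm_mul, norm_pow, norm_mul, hρ, Complex.norm_real, Complex.norm_real, one_mul, one_mul,
      Real.norm_eq_abs, Real.norm_of_nonneg hs.1.le]
    gcongr
    · exact hs.1.le
    · exact hs.2
  · exact Eventually.of_forall fun s hs => summable_ac hβ hβ1 hX.le
  · exact intervalIntegrable_const
  · refine Eventually.of_forall fun s hs => ?_
    refine HasSum.mul_left _ ?_
    have : Summable (fun n : ℕ => (ac β n : ℂ) * (ρ * s) ^ n) := by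
      refine Summable.of_norm ?_
      refine (summable_ac hβ hβ1 (norm_nonneg (ρ * s))).congr fun n => ?_
      rw [norm_mul (ac β n : ℂ), norm_pow, Complex.norm_real, Real.norm_eq_abs]
    exact this.hasSum

theorem int_exp {β : ℝ} (hβ : 0 < β) (n : ℕ) :
    ∫ θ in (-1:ℝ)..1, Complex.exp (θ * (π * β * Complex.I)) ^ (n + 1) =
      2 * Complex.sin (π * (β * (n + 1))) / (π * (β * (n + 1))) := by
  have hπ : (π : ℂ) ≠ 0 := by exact_mod_cast Real.pi_ne_zero
  have hβ' : (β : ℂ) ≠ 0 := by exact_mod_cast hβ.ne'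
  have hn : (n : ℂ) + 1 ≠ 0 := by exact_mod_cast n.succ_ne_zero
  have hc : (π * (β * (n + 1))) * Complex.I ≠ 0 := by simp [hπ, hβ', hn]
  have h := integral_exp_mul_complex (a := -1) (b := 1) hc
  have e : ∀ θ : ℝ, Complex.exp (θ * (π * β * Complex.I)) ^ (n + 1) = Complex.exp ((π * (β * (n + 1))) * Complex.I * θ) := by
    intro θ
    rw [← Complex.exp_nat_mul]; congr 1; push_cast; ring
  simp_rw [e]
  rw [h, Complex.two_sin]
  have hI : Complex.I ≠ 0 := Complex.I_ne_zero
  have hI2 : Complex.I ^ 2 = -1 := Complex.I_sq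
  rw [div_eq_div_iff hc (by simp [hπ, hβ', hn])]
  push_cast
  rw [mul_one, mul_neg, mul_one, neg_mul]
  linear_combination ((Complex.exp (π * (β * (n + 1)) * Complex.I) - Complex.exp (-(π * (β * (n + 1)) * Complex.I))) * (π * (β * (n + 1)))) * hI2

theorem int_EE {β : ℝ} (hβ : 0 < β) (hβ1 : β < 1) (z : ℂ) :
    HasSum (fun n : ℕ => (ec β n : ℂ) * z ^ n * ∫ θ in (-1:ℝ)..1, Complex.exp (θ * (π * β * Complex.I)) ^ n)
      (∫ θ in (-1:ℝ)..1, EE β (z * Complex.exp (θ * (π * β * Complex.I)))) := by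
  have hn1 : ∀ θ : ℝ, ‖Complex.exp (θ * (π * β * Complex.I))‖ = 1 := by
    intro θ
    rw [Complex.norm_exp]; simp
  have := intervalIntegral.hasSum_integral_of_dominated_convergence (μ := volume) (a := -1) (b := 1)
    (F := fun (n : ℕ) (θ : ℝ) => (ec β n : ℂ) * z ^ n * Complex.exp (θ * (π * β * Complex.I)) ^ n)
    (f := fun θ => EE β (z * Complex.exp (θ * (π * β * Complex.I))))
    (fun n _ => ec β n * ‖z‖ ^ n) (fun n => by fun_prop) ?_ ?_ ?_ ?_
  · simpa only [intervalIntegral.integral_const_mul] using this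
  · intro n
    refine Eventually.of_forall fun s hs => ?_
    rw [norm_mul, norm_mul, norm_pow, norm_pow, hn1, one_pow, mul_one, Complex.norm_real,
      Real.norm_of_nonneg (ec_nonneg hβ n)]
  · exact Eventually.of_forall fun s hs => summable_ec hβ hβ1 (norm_nonneg z)
  · exact intervalIntegrable_const
  · refine Eventually.of_forall fun s hs => ?_
    have := (summable_norm_EE hβ hβ1 (z * Complex.exp (s * (π * β * Complex.I)))).of_norm.hasSum
    rw [EE]
    convert this using 1
    funext n
    rw [mul_pow]; ring

theorem int_ph_eq {β : ℝ} (hβ : 0 < β) (hβ1 : β < 1) {ρ : ℂ} (hρ : ‖ρ‖ = 1) {X : ℝ} (hX : 0 < X) :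
    ∫ s in (0:ℝ)..X, ρ * ph β (ρ * s) =
      (1 / 2) * (∫ θ in (-1:ℝ)..1, EE β (ρ * X * Complex.exp (θ * (π * β * Complex.I)))) - 1 := by
  have h1 := int_ph hβ hβ1 hρ hX
  have h2 := int_EE hβ hβ1 (ρ * X)
  have h3 := h2.summable.tsum_eq_zero_add
  rw [h2.tsum_eq] at h3
  rw [h3, ← h1.tsum_eq]
  have e0 : (ec β 0 : ℂ) = 1 := by simp [ec]
  have hπ : (π : ℂ) ≠ 0 := by exact_mod_cast Real.pi_ne_zero
  have hβ' : (β : ℂ) ≠ 0 := by exact_mod_cast hβ.ne'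
  have e1 : ∑' b : ℕ, (ec β (b + 1) : ℂ) * (ρ * X) ^ (b + 1) * ∫ θ in (-1:ℝ)..1, Complex.exp (θ * (π * β * Complex.I)) ^ (b + 1)
     = 2 * ∑' n : ℕ, (ac β n : ℂ) * (ρ * X) ^ (n + 1) / (n + 1) := by
    rw [← tsum_mul_left]
    refine tsum_congr fun n => ?_
    have hn : (n : ℂ) + 1 ≠ 0 := by exact_mod_cast n.succ_ne_zero
    rw [int_exp hβ, ac]
    push_cast
    field_simp
  rw [e1, e0]
  simp
  ring

theorem integral_ray {β : ℝ} (hβ : 0 < β) (hβ1 : β < 1) {ρ : ℂ} {δ k : ℝ} (hg : Good β ρ δ k) :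
    ∫ s in Ioi (0:ℝ), ρ * ph β (ρ * s) = -1 := by
  have h1 := intervalIntegral_tendsto_integral_Ioi 0 ((ph_integrable hβ hβ1 hg).const_mul ρ) tendsto_id
  refine tendsto_nhds_unique h1 ?_
  have h2 : Tendsto (fun X : ℝ => ∫ θ in (-1:ℝ)..1, EE β (ρ * X * Complex.exp (θ * (π * β * Complex.I)))) atTop (𝓝 0) := by
    have h3 : Tendsto (fun X : ℝ => X ^ (-1 / β) * (k ^ (-1 / β) * Real.Gamma (1 / β + 1)) * |(1:ℝ) - (-1)|) atTop (𝓝 0) := by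
      have : Tendsto (fun X : ℝ => X ^ (-(1 / β))) atTop (𝓝 0) := tendsto_rpow_neg_atTop (by positivity)
      have := (this.mul_const (k ^ (-1 / β) * Real.Gamma (1 / β + 1))).mul_const (|(1:ℝ) - (-1)|)
      simpa only [zero_mul, neg_div] using this
    refine squeeze_zero_norm' ?_ h3
    filter_upwards [eventually_gt_atTop 0] with X hX
    refine intervalIntegral.norm_integral_le_of_norm_le_const fun θ hθ => ?_
    rw [uIoc_of_le (by norm_num)] at hθ
    exact good_EE hβ hβ1 hg ⟨hθ.1.le, hθ.2⟩ hX
  have h4 := (h2.const_mul (1 / 2 : ℂ)).sub_const 1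
  rw [mul_zero, zero_sub] at h4
  refine h4.congr' ?_
  filter_upwards [eventually_gt_atTop 0] with X hX
  exact (int_ph_eq hβ hβ1 hg.1 hX).symm

end WK

namespace WK

theorem sin_ge {γ x : ℝ} (hγ : 0 < γ) (hx1 : γ ≤ x) (hx2 : x ≤ π - γ) : Real.sin γ ≤ Real.sin x := by
  rcases le_total x (π / 2) with h | h
  · exact Real.sin_le_sin_of_le_of_le_pi_div_two (by linarith [Real.pi_pos]) h hx1
  · rw [← Real.sin_pi_sub x]
    exact Real.sin_le_sin_of_le_of_le_pi_div_two (by linarith [Real.pi_pos]) (by linarith) (by linarith)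

theorem good_of_angle {β δ γ ψ : ℝ} (hδ : |δ| < π / 2) (hγ : 0 < γ) (hγ1 : γ < π)
    (h : ∀ θ ∈ Set.Icc (-1:ℝ) 1, π / 2 + γ ≤ ψ + θ * (π * β) + β * δ ∧ ψ + θ * (π * β) + β * δ ≤ 3 * π / 2 - γ) :
    Good β (Complex.exp (ψ * Complex.I)) δ (Real.sin γ) := by
  refine ⟨Complex.norm_exp_ofReal_mul_I _, hδ, Real.sin_pos_of_pos_of_lt_pi hγ hγ1, fun θ hθ => ?_⟩
  rw [← Complex.exp_add, ← Complex.exp_add]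
  have e : (ψ:ℂ) * Complex.I + θ * (π * β * Complex.I) + β * δ * Complex.I =
    ((ψ + θ * (π * β) + β * δ : ℝ) : ℂ) * Complex.I := by push_cast; ring
  rw [e, Complex.exp_ofReal_mul_I_re]
  have h1 := h θ hθ
  have h2 := sin_ge (x := ψ + θ * (π * β) + β * δ - π / 2) hγ (by linarith) (by linarith)
  rw [Real.sin_sub_pi_div_two] at h2
  linarith

theorem good_neg {β : ℝ} (hβ : 0 < β) (hβ1 : β < 1 / 3) : ∃ δ k, Good β (-1) δ k := by
  have hπ := Real.pi_pos
  refine ⟨0, Real.sin (π / 6), ?_⟩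
  rw [← Complex.exp_pi_mul_I]
  refine good_of_angle (by simp; positivity) (by positivity) (by linarith) fun θ hθ => ?_
  have hb : 0 < π * β := by positivity
  have hb2 : π * β < π / 3 := by nlinarith
  obtain ⟨h1, h2⟩ := hθ
  constructor <;> nlinarith

theorem good_e23 {β : ℝ} (hβ : 0 < β) (hβ1 : β < 1 / 3) : ∃ δ k, Good β e23 δ k := by
  have hπ := Real.pi_pos
  have hlt : max 0 (π - π / (6 * β)) < π / 2 := by
    refine max_lt (by positivity) ?_
    have : π / 2 < π / (6 * β) := by
      apply div_lt_div_of_pos_left hπ (by positivity) (by linarith)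
    linarith
  obtain ⟨δ, hδ1, hδ2⟩ := exists_between hlt
  have hδ0 : 0 < δ := lt_of_le_of_lt (le_max_left _ _) hδ1
  have hδ3 : π - π / (6 * β) < δ := lt_of_le_of_lt (le_max_right _ _) hδ1
  have hA : 0 < π / 6 - π * β + β * δ := by
    have : β * (π - π / (6 * β)) < β * δ := by gcongr
    have e : β * (π - π / (6 * β)) = π * β - π / 6 := by field_simp
    linarith
  refine ⟨δ, Real.sin (min (π / 6 - π * β + β * δ) (π / 3)), ?_⟩
  have he : e23 = Complex.exp (((2 * π / 3 : ℝ) : ℂ) * Complex.I) := by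
    rw [e23]; congr 1; push_cast; ring
  rw [he]
  have m1 := min_le_left (π / 6 - π * β + β * δ) (π / 3)
  have m2 := min_le_right (π / 6 - π * β + β * δ) (π / 3)
  refine good_of_angle (by rwa [abs_of_pos hδ0]) (lt_min hA (by positivity)) (by linarith) fun θ hθ => ?_
  have hb : 0 < π * β := by positivity
  have hb2 : π * β < π / 3 := by nlinarith
  have hb3 : β * δ < π / 6 := by nlinarith
  obtain ⟨h1, h2⟩ := hθ
  constructor <;> nlinarith

/-- The self-similar profile of the kernel. -/
noncomputable def KK (β y : ℝ) : ℝ :=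
  if y < 0 then (1/3) * (ph β (y:ℂ)).re else -(2/3) * (e23 * ph β (e23 * (y:ℂ))).re

theorem KK_neg {β : ℝ} (hβ : 0 < β) (hβ1 : β < 1 / 3) :
    IntegrableOn (KK β) (Iic 0) ∧ ∫ y in Iic (0:ℝ), KK β y = 1 / 3 := by
  obtain ⟨δ, k, hg⟩ := good_neg hβ hβ1
  have h1 := (ph_integrable hβ (by linarith) hg).const_mul (-1)
  have h2 := integral_ray hβ (by linarith) hg
  have h3 : IntegrableOn (fun s : ℝ => -(1/3) * (-1 * ph β (-1 * s)).re) (Ioi 0) := (Integrable.re h1).const_mul _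
  have h4 : ∫ s in Ioi (0:ℝ), -(1/3) * (-1 * ph β (-1 * s)).re = 1 / 3 := by
    rw [integral_const_mul]
    have : ∫ s in Ioi (0:ℝ), (-1 * ph β (-1 * s)).re = (∫ s in Ioi (0:ℝ), -1 * ph β (-1 * s)).re :=
      integral_re h1
    rw [this, h2]; norm_num
  have e : ∀ s ∈ Ioi (0:ℝ), -(1/3) * (-1 * ph β (-1 * s)).re = KK β (-s) := by
    intro s hs
    have : -s < 0 := by simpa using hs
    rw [KK, if_pos this]; simp
  have h5 := h3.congr_fun e measurableSet_Ioi
  rw [setIntegral_congr_fun measurableSet_Ioi e] at h4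
  constructor
  · have h6 : IntegrableOn (fun x => KK β (-x)) (Ici (-0)) := by
      rw [neg_zero, integrableOn_Ici_iff_integrableOn_Ioi]; exact h5
    have := h6.comp_neg_Iic
    simpa using this
  · rw [← h4, integral_comp_neg_Ioi]; simp

theorem KK_pos {β : ℝ} (hβ : 0 < β) (hβ1 : β < 1 / 3) :
    IntegrableOn (KK β) (Ioi 0) ∧ ∫ y in Ioi (0:ℝ), KK β y = 2 / 3 := by
  obtain ⟨δ, k, hg⟩ := good_e23 hβ hβ1
  have h1 := (ph_integrable hβ (by linarith) hg).const_mul e23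
  have h2 := integral_ray hβ (by linarith) hg
  have h3 : IntegrableOn (fun s : ℝ => -(2/3) * (e23 * ph β (e23 * s)).re) (Ioi 0) := (Integrable.re h1).const_mul _
  have h4 : ∫ s in Ioi (0:ℝ), -(2/3) * (e23 * ph β (e23 * s)).re = 2 / 3 := by
    rw [integral_const_mul]
    have : ∫ s in Ioi (0:ℝ), (e23 * ph β (e23 * s)).re = (∫ s in Ioi (0:ℝ), e23 * ph β (e23 * s)).re :=
      integral_re h1
    rw [this, h2]; norm_num
  have e : ∀ s ∈ Ioi (0:ℝ), -(2/3) * (e23 * ph β (e23 * s)).re = KK β s := by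
    intro s hs
    have : ¬ s < 0 := not_lt.2 (le_of_lt hs)
    rw [KK, if_neg this]
  have h5 := h3.congr_fun e measurableSet_Ioi
  rw [setIntegral_congr_fun measurableSet_Ioi e] at h4
  exact ⟨h5, h4⟩

theorem KK_integrable {β : ℝ} (hβ : 0 < β) (hβ1 : β < 1 / 3) : Integrable (KK β) := by
  rw [← integrableOn_univ, ← Iic_union_Ioi (a := (0:ℝ))]
  exact (KK_neg hβ hβ1).1.union (KK_pos hβ hβ1).1

theorem KK_integral {β : ℝ} (hβ : 0 < β) (hβ1 : β < 1 / 3) : ∫ y, KK β y = 1 := by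
  rw [← intervalIntegral.integral_Iic_add_Ioi (KK_neg hβ hβ1).1 (KK_pos hβ hβ1).1, (KK_neg hβ hβ1).2, (KK_pos hβ hβ1).2]
  norm_num

theorem Ghat_scale {α : ℝ} (hα : 0 < α) {τ : ℝ} (hτ : 0 < τ) {y : ℝ} (hy : y ≠ 0) :
    τ ^ (α/3) * Ghat α (1 - α/3) (τ ^ (α/3) * y) τ = KK (α/3) y := by
  have hp : 0 < τ ^ (α/3) := Real.rpow_pos_of_pos hτ _
  have hne : τ ^ (α/3) * y ≠ 0 := mul_ne_zero hp.ne' hy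
  have hw : ∀ z, wrightPhi (-((α:ℂ)/3)) ((1 - α/3 : ℝ) : ℂ) z = ph (α/3) z := by
    intro z
    rw [← wright_eq (by positivity)]; push_cast; rfl
  have hd : τ ^ (α/3) * y / τ ^ (α/3) = y := by field_simp
  have hpp : τ ^ (α/3) * τ ^ (1 - α/3 - 1) = 1 := by
    rw [← Real.rpow_add hτ]; ring_nf; simp
  have hsgn : τ ^ (α/3) * y < 0 ↔ y < 0 := by
    constructor
    · intro h; by_contra h'; nlinarith [mul_nonneg hp.le (not_lt.1 h')]
    · intro h; exact mul_neg_of_pos_of_neg hp h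
  rw [Ghat, if_neg hne, Gfun, KK, hd, hw, hw]
  by_cases h : y < 0
  · rw [if_pos h, if_pos (hsgn.2 h)]
    linear_combination (1/3 * (ph (α/3) y).re) * hpp
  · rw [if_neg h, if_neg (fun h' => h (hsgn.1 h'))]
    linear_combination (-(2/3) * (e23 * ph (α/3) (e23 * y)).re) * hpp

theorem change_var {α : ℝ} (hα : 0 < α) {τ : ℝ} (hτ : 0 < τ) {a b : ℝ} (hab : a < b) (x : ℝ) (g : ℝ → ℝ) :
    ∫ ξ in a..b, Ghat α (1 - α/3) (x - ξ) τ * g ξ =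
      ∫ y, KK (α/3) y * (Ioc a b).indicator g (x - τ ^ (α/3) * y) := by
  have hp : 0 < τ ^ (α/3) := Real.rpow_pos_of_pos hτ _
  rw [intervalIntegral.integral_of_le hab.le, ← integral_indicator measurableSet_Ioc]
  set H : ℝ → ℝ := (Ioc a b).indicator fun ξ => Ghat α (1 - α/3) (x - ξ) τ * g ξ with hH
  rw [← integral_sub_left_eq_self H volume x]
  have h1 := Measure.integral_comp_mul_left (fun u => H (x - u)) (τ ^ (α/3))
  have h2 : ∫ u, H (x - u) = τ ^ (α/3) * ∫ y, H (x - τ ^ (α/3) * y) := by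
    rw [h1, abs_of_pos (by positivity), smul_eq_mul]; field_simp
  rw [h2, ← integral_const_mul]
  refine integral_congr_ae ?_
  have hae : ∀ᵐ y : ℝ, y ≠ 0 := by simp [ae_iff]
  filter_upwards [hae] with y hy
  rw [← Ghat_scale hα hτ hy, hH]
  by_cases hm : x - τ ^ (α/3) * y ∈ Ioc a b
  · rw [indicator_of_mem hm, indicator_of_mem hm, sub_sub_cancel]; ring
  · rw [indicator_of_notMem hm, indicator_of_notMem hm]; ring

end WK

/-- The approximate-identity property of the kernel `G_α^{1−α/3}`: for `f` continuous
and bounded on `[a,b]×[0,T]`, `∫_a^b G_α^{1−α/3}(x−ξ, t−η) f(ξ,η) dξ → f(x,t)` as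
`η → t⁻`, for every interior point `a < x < b` and every `0 < t ≤ T`. -/
theorem kernel_approximate_identity
    (α : ℝ) (hα0 : 0 < α) (hα1 : α < 1) (a b T : ℝ) (hab : a < b) (hT : 0 < T)
    (f : ℝ → ℝ → ℝ)
    (hfc : ContinuousOn (fun p : ℝ × ℝ => f p.1 p.2) (Set.Icc a b ×ˢ Set.Icc 0 T))
    (hfb : ∃ M, ∀ ξ ∈ Set.Icc a b, ∀ η ∈ Set.Icc 0 T, |f ξ η| ≤ M) :
    ∀ x ∈ Set.Ioo a b, ∀ t, 0 < t → t ≤ T →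
      Filter.Tendsto (fun η => ∫ ξ in a..b, Ghat α (1 - α/3) (x - ξ) (t - η) * f ξ η)
        (nhdsWithin t (Set.Iio t)) (nhds (f x t)) := by
  intro x hx t ht0 htT
  obtain ⟨M, hM⟩ := hfb
  have hβ : 0 < α / 3 := by positivity
  have hβ1 : α / 3 < 1 / 3 := by linarith
  have hev : ∀ᶠ η in 𝓝[<] t, η ∈ Ioo 0 t := Ioo_mem_nhdsLT ht0
  have hM0 : 0 ≤ M := le_trans (abs_nonneg _) (hM x ⟨hx.1.le, hx.2.le⟩ 0 ⟨le_rfl, hT.le⟩)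
  have hlim : ∫ y, WK.KK (α/3) y * f x t = f x t := by
    rw [integral_mul_const, WK.KK_integral hβ hβ1, one_mul]
  rw [← hlim]
  have hmain : Tendsto (fun η => ∫ y, WK.KK (α/3) y *
      (Ioc a b).indicator (fun ξ => f ξ η) (x - (t - η) ^ (α/3) * y)) (𝓝[<] t)
      (𝓝 (∫ y, WK.KK (α/3) y * f x t)) := by
    refine tendsto_integral_filter_of_dominated_convergence (fun y => |WK.KK (α/3) y| * M) ?_ ?_ ?_ ?_
    · filter_upwards [hev] with η hη
      refine (WK.KK_integrable hβ hβ1).aestronglyMeasurable.mul ?_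
      have hc : ContinuousOn (fun ξ => f ξ η) (Icc a b) :=
        hfc.comp (f := fun ξ => (ξ, η)) (by fun_prop) (fun ξ hξ => ⟨hξ, hη.1.le, hη.2.le.trans htT⟩)
      have hm : Measurable ((Ioc a b).indicator (fun ξ => f ξ η)) := by
        have hg : Continuous (IccExtend hab.le ((Icc a b).restrict fun ξ => f ξ η)) :=
          (continuousOn_iff_continuous_restrict.1 hc).Icc_extend'
        have he : (Ioc a b).indicator (fun ξ => f ξ η) =
            (Ioc a b).indicator (IccExtend hab.le ((Icc a b).restrict fun ξ => f ξ η)) := by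
          refine indicator_congr fun ξ hξ => ?_
          rw [IccExtend_of_mem _ _ (Ioc_subset_Icc_self hξ)]; rfl
        rw [he]
        exact hg.measurable.indicator measurableSet_Ioc
      exact (hm.comp (by fun_prop)).aestronglyMeasurable
    · filter_upwards [hev] with η hη
      refine Eventually.of_forall fun y => ?_
      rw [norm_mul, Real.norm_eq_abs]
      gcongr
      by_cases hm : x - (t - η) ^ (α/3) * y ∈ Ioc a b
      · rw [indicator_of_mem hm, Real.norm_eq_abs]
        exact hM _ (Ioc_subset_Icc_self hm) _ ⟨hη.1.le, hη.2.le.trans htT⟩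
      · rw [indicator_of_notMem hm, norm_zero]; exact hM0
    · exact (WK.KK_integrable hβ hβ1).abs.mul_const M
    · refine Eventually.of_forall fun y => ?_
      refine Tendsto.const_mul _ ?_
      have h1 : Tendsto (fun η => x - (t - η) ^ (α/3) * y) (𝓝[<] t) (𝓝 x) := by
        have : ContinuousAt (fun η => x - (t - η) ^ (α/3) * y) t := by
          refine ContinuousAt.sub continuousAt_const (ContinuousAt.mul ?_ continuousAt_const)
          exact ContinuousAt.rpow_const (by fun_prop) (Or.inr hβ.le)
        have h := this.tendsto
        simp only [sub_self, Real.zero_rpow hβ.ne', zero_mul, sub_zero] at h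
        exact h.mono_left nhdsWithin_le_nhds
      have h2 : ∀ᶠ η in 𝓝[<] t, x - (t - η) ^ (α/3) * y ∈ Ioc a b :=
        (h1.eventually (isOpen_Ioo.mem_nhds hx)).mono fun _ h => Ioo_subset_Ioc_self h
      have h3 : Tendsto (fun η => (x - (t - η) ^ (α/3) * y, η)) (𝓝[<] t)
          (𝓝[Icc a b ×ˢ Icc 0 T] (x, t)) := by
        refine tendsto_nhdsWithin_iff.2 ⟨h1.prodMk_nhds nhdsWithin_le_nhds, ?_⟩
        filter_upwards [h2, hev] with η h hη
        exact ⟨Ioc_subset_Icc_self h, hη.1.le, hη.2.le.trans htT⟩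
      have h4 := (hfc (x, t) ⟨⟨hx.1.le, hx.2.le⟩, ht0.le, htT⟩).tendsto.comp h3
      refine h4.congr' ?_
      filter_upwards [h2] with η h
      rw [indicator_of_mem h]; rfl
  refine hmain.congr' ?_
  filter_upwards [hev] with η hη
  exact (WK.change_var hα0 (sub_pos.2 hη.2) hab x (fun ξ => f ξ η)).symm
end

section
/- Let 0<α<1 and μ∈ℝ. Then for every x≠0 and t>0: (1) the third spatial derivative of the fundamental solution lowers the upper index by α: ∂³/∂x³ G_α^μ(x,t) = G_α^{μ−α}(x,t); and (2) for every δ>0, fractional integration in time raises the upper index by δ: J^δ_{0,t} G_α^μ(x,·)(t) = G_α^{μ+δ}(x,t). -/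
open MeasureTheory Real Filter Set Topology

noncomputable def rayI (f : ℂ → ℂ) (θ : ℝ) : ℂ :=
  ∫ r in Ioi (0:ℝ), f (1 + r * Complex.exp (θ * Complex.I)) * Complex.exp (θ * Complex.I)

lemma int_base : IntegrableOn (fun r : ℝ => (1 + r) ^ (-2:ℝ)) (Ioi 0) := by
  simpa [add_comm] using (integrableOn_add_rpow_Ioi_of_lt (a := (-2:ℝ)) (c := 0) (m := 1) (by norm_num) (by norm_num))

lemma int_ray {f : ℝ → ℂ} {C : ℝ} (hf : ContinuousOn f (Ioi 0))
    (hb : ∀ r > 0, ‖f r‖ ≤ C * (1 + r) ^ (-2:ℝ)) : IntegrableOn f (Ioi 0) := by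
  refine Integrable.mono' (int_base.const_mul C) (hf.aestronglyMeasurable measurableSet_Ioi) ?_
  exact (ae_restrict_iff' measurableSet_Ioi).mpr (Eventually.of_forall fun r hr => hb r hr)

lemma exp_cov_int {g : ℝ → ℂ} (hg : IntegrableOn g (Ioi 0)) :
    Integrable (fun x : ℝ => Real.exp x • g (Real.exp x)) := by
  have := (integrableOn_image_iff_integrableOn_abs_deriv_smul (f := Real.exp) (f' := Real.exp)
    MeasurableSet.univ (fun x _ => (Real.hasDerivAt_exp x).hasDerivWithinAt)
    Real.exp_injective.injOn g).mp (by simpa [Real.range_exp] using hg)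
  simpa [abs_of_pos (Real.exp_pos _)] using this

lemma exp_cov {g : ℝ → ℂ} :
    ∫ x : ℝ, Real.exp x • g (Real.exp x) = ∫ r in Ioi (0:ℝ), g r := by
  have := (integral_image_eq_integral_abs_deriv_smul (f := Real.exp) (f' := Real.exp)
    MeasurableSet.univ (fun x _ => (Real.hasDerivAt_exp x).hasDerivWithinAt)
    Real.exp_injective.injOn g)
  simpa [Real.range_exp, abs_of_pos (Real.exp_pos _)] using this.symm

lemma ray_rotate (f : ℂ → ℂ) (θ₁ θ₂ C : ℝ) (h12 : θ₁ ≤ θ₂)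
    (hd : ∀ r > (0:ℝ), ∀ φ ∈ Icc θ₁ θ₂, DifferentiableAt ℂ f (1 + r * Complex.exp (φ * Complex.I)))
    (hb : ∀ r > (0:ℝ), ∀ φ ∈ Icc θ₁ θ₂,
      ‖f (1 + r * Complex.exp (φ * Complex.I))‖ ≤ C * (1 + r) ^ (-2:ℝ)) :
    rayI f θ₁ = rayI f θ₂ := by
  set h : ℂ → ℂ := fun w => f (1 + Complex.exp w) * Complex.exp w with hh
  have hC : 0 ≤ C := by
    have := (norm_nonneg _).trans (hb 1 one_pos θ₁ ⟨le_rfl, h12⟩)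
    exact nonneg_of_mul_nonneg_left this (by positivity)
  have hexp : ∀ (x φ : ℝ), Complex.exp (x + φ * Complex.I)
      = (Real.exp x : ℝ) * Complex.exp (φ * Complex.I) := by
    intro x φ; rw [Complex.exp_add]; push_cast; rfl
  have hhx : ∀ (φ x : ℝ), h (x + φ * Complex.I) = Real.exp x •
      (fun r : ℝ => f (1 + r * Complex.exp (φ * Complex.I)) * Complex.exp (φ * Complex.I)) (Real.exp x) := by
    intro φ x
    simp only [hh, hexp, Complex.real_smul]; ring
  have hlim : ∀ φ ∈ Icc θ₁ θ₂, Tendsto (fun R : ℝ => ∫ x in (-R)..R, h (x + φ * Complex.I)) atTop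
      (𝓝 (rayI f φ)) := by
    intro φ hφ
    have hint : IntegrableOn (fun r : ℝ => f (1 + r * Complex.exp (φ * Complex.I)) * Complex.exp (φ * Complex.I)) (Ioi 0) := by
      refine int_ray (C := C) ?_ ?_
      · intro r hr
        refine ContinuousAt.continuousWithinAt ?_
        refine ContinuousAt.mul ?_ continuousAt_const
        exact ContinuousAt.comp (f := fun r : ℝ => 1 + (r:ℂ) * Complex.exp (φ * Complex.I)) (g := f) (hd r hr φ hφ).continuousAt (by fun_prop)
      · intro r hr
        rw [norm_mul, Complex.norm_exp_ofReal_mul_I, mul_one]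
        exact hb r hr φ hφ
    have h1 := intervalIntegral_tendsto_integral (exp_cov_int hint)
      (tendsto_neg_atTop_atBot) tendsto_id
    rw [exp_cov (g := fun r : ℝ => f (1 + r * Complex.exp (φ * Complex.I)) * Complex.exp (φ * Complex.I))] at h1
    simp only [hhx]
    exact h1
  have hside : ∀ (x : ℝ), ‖∫ y in θ₁..θ₂, h (x + y * Complex.I)‖ ≤
      C * (Real.exp x / (1 + Real.exp x) ^ 2) * |θ₂ - θ₁| := by
    intro x
    apply intervalIntegral.norm_integral_le_of_norm_le_const
    intro y hy
    rw [uIoc_of_le h12] at hy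
    rw [hhx, norm_smul, norm_mul, Complex.norm_exp_ofReal_mul_I, mul_one, Real.norm_eq_abs, Real.abs_exp]
    have := hb _ (Real.exp_pos x) y ⟨hy.1.le, hy.2⟩
    have e : (1 + Real.exp x) ^ (-2:ℝ) = 1 / (1 + Real.exp x)^2 := by
      rw [Real.rpow_neg (by positivity)]; norm_num
    rw [e] at this
    calc _ ≤ Real.exp x * (C * (1 / (1 + Real.exp x)^2)) := by gcongr
      _ = _ := by ring
  have hs1 : Tendsto (fun x : ℝ => C * (Real.exp x / (1 + Real.exp x) ^ 2) * |θ₂ - θ₁|) atTop (𝓝 0) := by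
    have : Tendsto (fun x : ℝ => C * Real.exp (-x) * |θ₂ - θ₁|) atTop (𝓝 0) := by
      simpa using ((Real.tendsto_exp_neg_atTop_nhds_zero.const_mul C).mul_const |θ₂ - θ₁|)
    refine squeeze_zero (fun x => by positivity) (fun x => ?_) this
    gcongr
    rw [Real.exp_neg, div_le_iff₀ (by positivity)]
    have := Real.exp_pos x
    field_simp
    nlinarith
  have hs2 : Tendsto (fun x : ℝ => C * (Real.exp (-x) / (1 + Real.exp (-x)) ^ 2) * |θ₂ - θ₁|) atTop (𝓝 0) := by
    have : Tendsto (fun x : ℝ => C * Real.exp (-x) * |θ₂ - θ₁|) atTop (𝓝 0) := by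
      simpa using ((Real.tendsto_exp_neg_atTop_nhds_zero.const_mul C).mul_const |θ₂ - θ₁|)
    refine squeeze_zero (fun x => by positivity) (fun x => ?_) this
    gcongr
    rw [div_le_iff₀ (by positivity)]
    have := Real.exp_pos (-x)
    nlinarith [mul_pos this this, mul_pos (mul_pos this this) this]
  have hR1 : Tendsto (fun x : ℝ => ∫ y in θ₁..θ₂, h ((x:ℝ) + y * Complex.I)) atTop (𝓝 0) :=
    squeeze_zero_norm (fun x => hside x) hs1
  have hR2 : Tendsto (fun x : ℝ => ∫ y in θ₁..θ₂, h (((-x:ℝ):ℂ) + y * Complex.I)) atTop (𝓝 0) :=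
    squeeze_zero_norm (fun x => hside (-x)) hs2
  have hrect : ∀ R : ℝ, (((∫ x in (-R)..R, h (x + θ₁ * Complex.I)) - ∫ x in (-R)..R, h (x + θ₂ * Complex.I)) +
          Complex.I • ∫ y in θ₁..θ₂, h ((R:ℝ) + y * Complex.I)) -
        Complex.I • ∫ y in θ₁..θ₂, h (((-R:ℝ):ℂ) + y * Complex.I) = 0 := by
    intro R
    have := Complex.integral_boundary_rect_eq_zero_of_differentiableOn h (⟨-R, θ₁⟩) (⟨R, θ₂⟩) (by
      intro w hw
      rw [Complex.mem_reProdIm] at hw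
      have h2 := hw.2
      simp only [uIcc_of_le h12] at h2
      refine DifferentiableAt.differentiableWithinAt ?_
      have h3 := hd (Real.exp w.re) (Real.exp_pos _) w.im h2
      rw [← hexp, Complex.re_add_im] at h3
      refine DifferentiableAt.mul ?_ Complex.differentiableAt_exp
      exact DifferentiableAt.comp (f := fun w => 1 + Complex.exp w) (g := f) w h3 (by fun_prop))
    simpa using this
  have hl := ((hlim θ₁ ⟨le_rfl, h12⟩).sub (hlim θ₂ ⟨h12, le_rfl⟩)).add (hR1.const_smul Complex.I)
  have hl := hl.sub (hR2.const_smul Complex.I)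
  simp only [hrect] at hl
  have := tendsto_nhds_unique hl tendsto_const_nhds
  simp at this
  linear_combination this

lemma norm_ge (θ₀ : ℝ) (hθ₀ : 0 < θ₀) (hθ : θ₀ < π) :
    ∃ k > 0, k ≤ 1 ∧ ∀ r ≥ (0:ℝ), ∀ φ ∈ Icc (-θ₀) θ₀,
      k * (1 + r) ≤ ‖1 + (r:ℂ) * Complex.exp (φ * Complex.I)‖ := by
  have hc1 : -1 < Real.cos θ₀ := by
    rw [← Real.cos_pi]
    exact Real.cos_lt_cos_of_nonneg_of_le_pi hθ₀.le le_rfl hθ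
  have hc2 := Real.cos_le_one θ₀
  set q := Real.cos θ₀
  refine ⟨(1 + q) / 2, by linarith, by linarith, fun r hr φ hφ => ?_⟩
  have hq : q ≤ Real.cos φ := by
    rw [← Real.cos_abs φ]
    exact Real.cos_le_cos_of_nonneg_of_le_pi (abs_nonneg _) hθ.le (abs_le.mpr hφ)
  have hn : ‖1 + (r:ℂ) * Complex.exp (φ * Complex.I)‖ ^ 2 = 1 + 2 * r * Real.cos φ + r ^ 2 := by
    rw [Complex.sq_norm, Complex.normSq_apply]
    simp [Complex.exp_ofReal_mul_I_re, Complex.exp_ofReal_mul_I_im]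
    nlinarith [Real.sin_sq_add_cos_sq φ]
  refine le_of_sq_le_sq ?_ (norm_nonneg _) 
  rw [hn]
  have h1 : 1 + 2 * r * q + r^2 ≤ 1 + 2 * r * Real.cos φ + r ^ 2 := by nlinarith
  refine le_trans ?_ h1
  have : ((1+q)/2)^2 ≤ (1+q)/2 := by nlinarith
  have h3 : ((1 + q) / 2 * (1 + r))^2 ≤ (1+q)/2 * (1+r)^2 := by
    rw [mul_pow]; gcongr
  refine h3.trans ?_
  nlinarith [mul_nonneg (sub_nonneg.mpr hc2) (sq_nonneg (1 - r))]

lemma norm_le_ray (r φ : ℝ) (hr : 0 ≤ r) : ‖1 + (r:ℂ) * Complex.exp (φ * Complex.I)‖ ≤ 1 + r := by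
  refine (norm_add_le _ _).trans ?_
  rw [norm_mul, Complex.norm_exp_ofReal_mul_I]
  simp [abs_of_nonneg hr]

lemma arg_le (θ₀ : ℝ) (hθ₀ : π / 2 ≤ θ₀) (hθ : θ₀ < π) (r : ℝ) (hr : 0 ≤ r) (φ : ℝ)
    (hφ : φ ∈ Icc (-θ₀) θ₀) :
    1 + (r:ℂ) * Complex.exp (φ * Complex.I) ≠ 0 ∧
    |Complex.arg (1 + (r:ℂ) * Complex.exp (φ * Complex.I))| ≤ θ₀ := by
  have hpi := Real.pi_pos
  obtain ⟨k, hk, -, hkk⟩ := norm_ge θ₀ (by linarith) hθ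
  have hs := hkk r hr φ hφ
  have hpos : 0 < ‖1 + (r:ℂ) * Complex.exp (φ * Complex.I)‖ := lt_of_lt_of_le (by positivity) hs
  have h0 : 1 + (r:ℂ) * Complex.exp (φ * Complex.I) ≠ 0 := norm_pos_iff.mp hpos
  refine ⟨h0, ?_⟩
  by_contra hcon
  push Not at hcon
  have hlt : Real.cos |Complex.arg (1 + (r:ℂ) * Complex.exp (φ * Complex.I))| < Real.cos θ₀ :=
    Real.cos_lt_cos_of_nonneg_of_le_pi (by linarith) (Complex.abs_arg_le_pi _) hcon
  rw [Real.cos_abs, Complex.cos_arg h0, div_lt_iff₀ hpos] at hlt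
  have hq : Real.cos θ₀ ≤ Real.cos φ := by
    rw [← Real.cos_abs φ]
    exact Real.cos_le_cos_of_nonneg_of_le_pi (abs_nonneg _) hθ.le (abs_le.mpr hφ)
  have hq0 : Real.cos θ₀ ≤ 0 := Real.cos_nonpos_of_pi_div_two_le_of_le hθ₀ (by linarith)
  have hq1 := Real.neg_one_le_cos θ₀
  have hre : (1 + (r:ℂ) * Complex.exp (φ * Complex.I)).re = 1 + r * Real.cos φ := by
    simp [Complex.exp_ofReal_mul_I_re]
  have hn : r - 1 ≤ ‖1 + (r:ℂ) * Complex.exp (φ * Complex.I)‖ := by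
    have := norm_sub_le (1 + (r:ℂ) * Complex.exp (φ * Complex.I)) 1
    rw [add_sub_cancel_left, norm_mul, Complex.norm_exp_ofReal_mul_I] at this
    simp [abs_of_nonneg hr] at this
    linarith
  rw [hre] at hlt
  nlinarith

lemma slit_ray (θ₀ : ℝ) (hθ₀ : π / 2 ≤ θ₀) (hθ : θ₀ < π) (r : ℝ) (hr : 0 ≤ r) (φ : ℝ)
    (hφ : φ ∈ Icc (-θ₀) θ₀) : 1 + (r:ℂ) * Complex.exp (φ * Complex.I) ∈ Complex.slitPlane := by
  obtain ⟨h0, h1⟩ := arg_le θ₀ hθ₀ hθ r hr φ hφ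
  rw [Complex.mem_slitPlane_iff_arg]
  refine ⟨fun h => ?_, h0⟩
  rw [h] at h1
  have := le_abs_self π
  linarith

/-- bound of real powers along the rays -/
lemma pow_ray (θ₀ : ℝ) (hθ₀ : π / 2 ≤ θ₀) (hθ : θ₀ < π) (p : ℝ) :
    ∃ C ≥ 0, ∀ r ≥ (0:ℝ), ∀ φ ∈ Icc (-θ₀) θ₀,
      ‖(1 + (r:ℂ) * Complex.exp (φ * Complex.I)) ^ (p:ℂ)‖ ≤ C * (1 + r) ^ p := by
  have hpi := Real.pi_pos
  obtain ⟨k, hk, -, hkk⟩ := norm_ge θ₀ (by linarith) hθ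
  refine ⟨1 + k ^ p, by positivity, fun r hr φ hφ => ?_⟩
  rw [Complex.norm_cpow_real]
  have h1 := hkk r hr φ hφ
  have h2 := norm_le_ray r φ hr
  have hy : 0 ≤ (1 + r) ^ p := by positivity
  have hkp : 0 ≤ k ^ p := by positivity
  rcases le_total 0 p with hp | hp
  · calc _ ≤ (1 + r) ^ p := by gcongr
      _ ≤ _ := by nlinarith
  · calc _ ≤ (k * (1 + r)) ^ p := Real.rpow_le_rpow_of_nonpos (by positivity) h1 hp
      _ = k ^ p * (1 + r) ^ p := Real.mul_rpow hk.le (by positivity)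
      _ ≤ _ := by nlinarith

def GoodC (a θ₀ : ℝ) (c : ℂ) : Prop :=
  ∃ κ > 0, ∀ s : ℂ, s ≠ 0 → |Complex.arg s| ≤ θ₀ → κ * ‖s‖ ^ a ≤ (c * s ^ (a:ℂ)).re

lemma goodC_of (a θ₀ : ℝ) (ha : 0 < a) (hθ : a * θ₀ < π / 6) (hθ0 : 0 ≤ θ₀) (ρ ψ : ℝ) (hρ : 0 < ρ) (hψ : |ψ| ≤ π / 3) :
    GoodC a θ₀ (ρ * Complex.exp (ψ * Complex.I)) := by
  have hpi := Real.pi_pos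
  refine ⟨ρ * Real.cos (π / 3 + a * θ₀), mul_pos hρ (Real.cos_pos_of_mem_Ioo ⟨by nlinarith, by linarith⟩), ?_⟩
  intro s hs harg
  have e : (ρ * Complex.exp (ψ * Complex.I)) * s ^ (a:ℂ)
      = ((ρ * ‖s‖ ^ a : ℝ) : ℂ) * Complex.exp ((ψ + a * Complex.arg s : ℝ) * Complex.I) := by
    rw [Complex.cpow_def_of_ne_zero hs, Real.rpow_def_of_pos (norm_pos_iff.mpr hs)]
    push_cast
    rw [mul_assoc, mul_assoc, ← Complex.exp_add, ← Complex.exp_add, Complex.ofReal_log (norm_nonneg _)]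
    congr 2
    have := Complex.log_im s
    have h2 := Complex.re_add_im (Complex.log s)
    rw [Complex.log_re, Complex.log_im, Complex.ofReal_log (norm_nonneg _)] at h2
    rw [← h2]
    ring
  rw [e, Complex.re_ofReal_mul, Complex.exp_ofReal_mul_I_re]
  have hcos : Real.cos (π / 3 + a * θ₀) ≤ Real.cos (ψ + a * Complex.arg s) := by
    rw [← Real.cos_abs (ψ + _)]
    apply Real.cos_le_cos_of_nonneg_of_le_pi (abs_nonneg _) (by linarith)
    refine (abs_add_le _ _).trans ?_
    rw [abs_mul, abs_of_pos ha]
    gcongr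
  have : 0 ≤ ρ * ‖s‖ ^ a := by positivity
  nlinarith

lemma poly_exp (a p κ : ℝ) (ha : 0 < a) (hκ : 0 < κ) :
    ∃ C ≥ 0, ∀ y ≥ (1:ℝ), y ^ p * Real.exp (-(κ * y ^ a)) ≤ C := by
  obtain ⟨m, hm⟩ := exists_nat_ge (p / a)
  refine ⟨m.factorial / κ ^ m, by positivity, fun y hy => ?_⟩
  have hy0 : 0 < y := by linarith
  have h1 : y ^ p ≤ (y ^ a) ^ m := by
    rw [← Real.rpow_natCast, ← Real.rpow_mul hy0.le]
    apply Real.rpow_le_rpow_of_exponent_le hy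
    rw [div_le_iff₀ ha] at hm
    linarith
  have h2 := Real.pow_div_factorial_le_exp (κ * y ^ a) (by positivity) m
  rw [Real.exp_neg, ← div_eq_mul_inv, div_le_iff₀ (Real.exp_pos _), div_mul_eq_mul_div, le_div_iff₀ (by positivity)]
  rw [div_le_iff₀ (by positivity), mul_pow] at h2
  have : 0 ≤ κ ^ m := by positivity
  nlinarith

/-- the kernel without the exponential in time -/
noncomputable def wker (a μ : ℝ) (c s : ℂ) : ℂ := s ^ ((-μ : ℝ) : ℂ) * Complex.exp (-(c * s ^ (a:ℂ)))

lemma ker_ray (a θ₀ : ℝ) (ha : 0 < a) (hθ₀ : π / 2 ≤ θ₀) (hθ : θ₀ < π) (c : ℂ) (hc : GoodC a θ₀ c) (μ : ℝ) :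
    ∃ C ≥ 0, ∀ r ≥ (0:ℝ), ∀ φ ∈ Icc (-θ₀) θ₀,
      ‖wker a μ c (1 + (r:ℂ) * Complex.exp (φ * Complex.I))‖ ≤ C * (1 + r) ^ (-2:ℝ) := by
  have hpi := Real.pi_pos
  obtain ⟨k, hk, -, hkk⟩ := norm_ge θ₀ (by linarith) hθ
  obtain ⟨C1, hC1, h1⟩ := pow_ray θ₀ hθ₀ hθ (-μ)
  obtain ⟨κ, hκ, h2⟩ := hc
  obtain ⟨C2, hC2, h3⟩ := poly_exp a (-μ + 2) (κ * k ^ a) ha (by positivity)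
  refine ⟨C1 * C2, by positivity, fun r hr φ hφ => ?_⟩
  have e1 := h1 r hr φ hφ
  obtain ⟨hs0, harg⟩ := arg_le θ₀ hθ₀ hθ r hr φ hφ
  have e2 := h2 _ hs0 harg
  have e3 := h3 (1 + r) (by linarith)
  have e4 := hkk r hr φ hφ
  set s := 1 + (r:ℂ) * Complex.exp (φ * Complex.I)
  have hr1 : 0 < 1 + r := by linarith
  have e5 : κ * k ^ a * (1 + r) ^ a ≤ (c * s ^ (a:ℂ)).re := by
    refine le_trans ?_ e2
    rw [mul_assoc, ← Real.mul_rpow hk.le hr1.le]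
    gcongr
  rw [wker, norm_mul, Complex.norm_exp]
  have e6 : Real.exp (-(c * s ^ (a:ℂ))).re ≤ Real.exp (-(κ * k ^ a * (1 + r) ^ a)) := by
    rw [Complex.neg_re]; gcongr
  calc _ ≤ C1 * (1 + r) ^ (-μ) * Real.exp (-(κ * k ^ a * (1 + r) ^ a)) := by gcongr
    _ = C1 * ((1 + r) ^ (-μ + 2) * Real.exp (-(κ * k ^ a * (1 + r) ^ a))) * (1 + r) ^ (-2:ℝ) := by
      have : (1 + r) ^ (-μ) = (1 + r) ^ (-μ + 2) * (1 + r) ^ (-2:ℝ) := by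
        rw [← Real.rpow_add hr1]; ring_nf
      rw [this]; ring
    _ ≤ _ := by gcongr

lemma ker_diff (a μ : ℝ) (c s : ℂ) (hs : s ∈ Complex.slitPlane) : DifferentiableAt ℂ (wker a μ c) s := by
  unfold wker
  have h0 : ∀ p : ℂ, DifferentiableAt ℂ (fun s : ℂ => s ^ p) s := fun p =>
    differentiableAt_id.cpow_const hs
  have := h0 ((-μ : ℝ) : ℂ)
  have := h0 a
  fun_prop

lemma exp_norm (t r φ : ℝ) : ‖Complex.exp ((1 + (r:ℂ) * Complex.exp (φ * Complex.I)) * t)‖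
    = Real.exp ((1 + r * Real.cos φ) * t) := by
  rw [Complex.norm_exp, Complex.re_mul_ofReal]
  simp [Complex.exp_ofReal_mul_I_re]

noncomputable def tE (g : ℂ → ℂ) (t : ℝ) : ℂ → ℂ := fun s => Complex.exp (s * t) * g s

noncomputable def ctr (f : ℂ → ℂ) (θ : ℝ) : ℂ := rayI f θ - rayI f (-θ)

def Nice (θ₀ : ℝ) (g : ℂ → ℂ) : Prop :=
  (∀ s ∈ Complex.slitPlane, DifferentiableAt ℂ g s) ∧ ∃ C ≥ 0, ∀ r ≥ (0:ℝ), ∀ φ ∈ Icc (-θ₀) θ₀,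
      ‖g (1 + (r:ℂ) * Complex.exp (φ * Complex.I))‖ ≤ C * (1 + r) ^ (-2:ℝ)

lemma tE_diff {g : ℂ → ℂ} (t : ℝ) {s : ℂ} (h : DifferentiableAt ℂ g s) : DifferentiableAt ℂ (tE g t) s := by
  unfold tE; fun_prop

lemma ctr_rotate (θ₀ : ℝ) (hθ₀ : π / 2 ≤ θ₀) (hθ : θ₀ < π) (g : ℂ → ℂ) (hg : Nice θ₀ g) (t : ℝ) (ht : 0 ≤ t) :
    ctr (tE g t) (π / 2) = ctr (tE g t) θ₀ := by
  have hpi := Real.pi_pos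
  obtain ⟨hd, C, hC, hb⟩ := hg
  have key : ∀ r > (0:ℝ), ∀ φ ∈ Icc (-θ₀) θ₀, Real.cos φ ≤ 0 →
      ‖tE g t (1 + (r:ℂ) * Complex.exp (φ * Complex.I))‖ ≤ (Real.exp t * C) * (1 + r) ^ (-2:ℝ) := by
    intro r hr φ hφ hcos
    rw [tE, norm_mul, exp_norm, mul_assoc]
    have := hb r hr.le φ hφ
    gcongr
    nlinarith [mul_nonneg hr.le ht]
  unfold ctr
  congr 1
  · refine ray_rotate _ _ _ (Real.exp t * C) hθ₀ ?_ ?_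
    · intro r hr φ hφ
      exact tE_diff t (hd _ (slit_ray θ₀ hθ₀ hθ r hr.le φ ⟨by linarith [hφ.1], hφ.2⟩))
    · intro r hr φ hφ
      exact key r hr φ ⟨by linarith [hφ.1], hφ.2⟩
        (Real.cos_nonpos_of_pi_div_two_le_of_le hφ.1 (by linarith [hφ.2]))
  · symm
    refine ray_rotate _ _ _ (Real.exp t * C) (by linarith) ?_ ?_
    · intro r hr φ hφ
      exact tE_diff t (hd _ (slit_ray θ₀ hθ₀ hθ r hr.le φ ⟨by linarith [hφ.1], by linarith [hφ.2]⟩))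
    · intro r hr φ hφ
      refine key r hr φ ⟨by linarith [hφ.1], by linarith [hφ.2]⟩ ?_
      rw [← Real.cos_neg]
      exact (Real.cos_nonpos_of_pi_div_two_le_of_le (by linarith [hφ.2]) (by linarith [hφ.1]))

lemma ctr_zero (θ₀ : ℝ) (hθ₀ : π / 2 ≤ θ₀) (hθ : θ₀ < π) (g : ℂ → ℂ) (hg : Nice θ₀ g) (t : ℝ) (ht : t ≤ 0) :
    ctr (tE g t) (π / 2) = 0 := by
  have hpi := Real.pi_pos
  obtain ⟨hd, C, hC, hb⟩ := hg
  unfold ctr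
  rw [sub_eq_zero]
  symm
  refine ray_rotate _ _ _ C (by linarith) ?_ ?_
  · intro r hr φ hφ
    exact tE_diff t (hd _ (slit_ray θ₀ hθ₀ hθ r hr.le φ ⟨by linarith [hφ.1], by linarith [hφ.2]⟩))
  · intro r hr φ hφ
    rw [tE, norm_mul, exp_norm]
    have := hb r hr.le φ ⟨by linarith [hφ.1], by linarith [hφ.2]⟩
    have hcos := Real.cos_nonneg_of_mem_Icc ⟨by linarith [hφ.1], hφ.2⟩
    have : Real.exp ((1 + r * Real.cos φ) * t) ≤ 1 := by
      rw [Real.exp_le_one_iff]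
      nlinarith [mul_nonneg hr.le hcos]
    calc _ ≤ 1 * (C * (1 + r) ^ (-2:ℝ)) := by gcongr
      _ = _ := one_mul _

lemma nice_wker (a θ₀ : ℝ) (ha : 0 < a) (hθ₀ : π / 2 ≤ θ₀) (hθ : θ₀ < π) (c : ℂ) (hc : GoodC a θ₀ c) (μ : ℝ) :
    Nice θ₀ (wker a μ c) :=
  ⟨fun s hs => ker_diff a μ c s hs, ker_ray a θ₀ ha hθ₀ hθ c hc μ⟩

lemma nice_pow (θ₀ : ℝ) (hθ₀ : π / 2 ≤ θ₀) (hθ : θ₀ < π) (ν : ℝ) (hν : 2 ≤ ν) :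
    Nice θ₀ (fun s => s ^ ((-ν:ℝ):ℂ)) := by
  refine ⟨fun s hs => differentiableAt_id.cpow_const hs, ?_⟩
  obtain ⟨C, hC, h⟩ := pow_ray θ₀ hθ₀ hθ (-ν)
  refine ⟨C, hC, fun r hr φ hφ => (h r hr φ hφ).trans ?_⟩
  gcongr
  · linarith

/-- Fubini on a single line -/
lemma line_cont (θ₀ : ℝ) (hθ₀ : π / 2 ≤ θ₀) (hθ : θ₀ < π) (φ : ℝ) (hφ : φ ∈ Icc (-θ₀) θ₀) (g : ℂ → ℂ)
    (hd : ∀ s ∈ Complex.slitPlane, DifferentiableAt ℂ g s) :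
    ContinuousOn (fun r : ℝ => g (1 + (r:ℂ) * Complex.exp (φ * Complex.I))) (Ici 0) := by
  intro r hr
  refine ContinuousAt.continuousWithinAt ?_
  exact ContinuousAt.comp (f := fun r : ℝ => 1 + (r:ℂ) * Complex.exp (φ * Complex.I)) (g := g)
    (hd _ (slit_ray θ₀ hθ₀ hθ r hr φ hφ)).continuousAt (by fun_prop)

/-- Laplace transform of a power, complex parameter -/
lemma lap_pow (δ : ℝ) (hδ : 0 < δ) (s : ℂ) (hs : 0 < s.re) :
    ∫ u in Ioi (0:ℝ), ((u ^ (δ - 1) : ℝ) : ℂ) * Complex.exp (-(s * u)) = Complex.Gamma δ * s ^ ((-δ:ℝ):ℂ) := by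
  set U : Set ℂ := {z | 0 < z.re} with hU
  have hUo : IsOpen U := isOpen_lt continuous_const Complex.continuous_re
  have hmeas : ∀ (p : ℝ) (z : ℂ), AEStronglyMeasurable (fun u : ℝ => ((u ^ p : ℝ) : ℂ) * Complex.exp (-(z * u))) (volume.restrict (Ioi 0)) := by
    intro p z
    refine ContinuousOn.aestronglyMeasurable ?_ measurableSet_Ioi
    intro u hu
    refine ContinuousAt.continuousWithinAt ?_
    refine ContinuousAt.mul ?_ (by fun_prop)
    exact Complex.continuous_ofReal.continuousAt.comp (Real.continuousAt_rpow_const u p (Or.inl (ne_of_gt hu)))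
  have hreal : ∀ (p b : ℝ), -1 < p → 0 < b → IntegrableOn (fun u : ℝ => u ^ p * Real.exp (-b * u)) (Ioi 0) := by
    intro p b hp hb
    exact integrableOn_rpow_mul_exp_neg_mul_rpow (p := 1) hp one_pos hb |>.congr_fun (fun u hu => by simp) measurableSet_Ioi
  have hint : ∀ (p : ℝ) (z : ℂ), -1 < p → 0 < z.re → IntegrableOn (fun u : ℝ => ((u ^ p : ℝ) : ℂ) * Complex.exp (-(z * u))) (Ioi 0) := by
    intro p z hp hz
    refine Integrable.mono' (hreal p z.re hp hz) (hmeas p z) ?_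
    refine (ae_restrict_iff' measurableSet_Ioi).mpr (Eventually.of_forall fun u hu => ?_)
    rw [norm_mul, Complex.norm_exp, Complex.norm_real, Real.norm_of_nonneg (Real.rpow_nonneg (le_of_lt hu) _)]
    simp
  have hL : DifferentiableOn ℂ (fun z : ℂ => ∫ u in Ioi (0:ℝ), ((u ^ (δ - 1) : ℝ) : ℂ) * Complex.exp (-(z * u))) U := by
    intro z hz
    refine DifferentiableAt.differentiableWithinAt ?_
    have hz' : 0 < z.re := hz
    refine (hasDerivAt_integral_of_dominated_loc_of_deriv_le (μ := volume.restrict (Ioi (0:ℝ)))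
      (F := fun (z:ℂ) (u:ℝ) => ((u ^ (δ - 1) : ℝ) : ℂ) * Complex.exp (-(z * u)))
      (F' := fun (z:ℂ) (u:ℝ) => ((u ^ (δ - 1) : ℝ) : ℂ) * (Complex.exp (-(z * u)) * (-u)))
      (s := Metric.ball z (z.re / 2)) (bound := fun u => u ^ δ * Real.exp (-(z.re / 2) * u)) (x₀ := z)
      (Metric.ball_mem_nhds z (by linarith)) (Eventually.of_forall fun w => hmeas _ w)
      (hint _ _ (by linarith) hz') ?_ ?_ (hreal _ _ (by linarith) (by linarith)) ?_).2.differentiableAt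
    · simp only [← mul_assoc]
      exact (hmeas _ z).mul (by fun_prop)
    · refine (ae_restrict_iff' measurableSet_Ioi).mpr (Eventually.of_forall fun u hu w hw => ?_)
      have hu0 : 0 < u := hu
      rw [norm_mul, norm_mul, Complex.norm_exp, Complex.norm_real, norm_neg, Complex.norm_real,
        Real.norm_of_nonneg (Real.rpow_nonneg hu0.le _), Real.norm_of_nonneg hu0.le]
      have e : u ^ δ = u ^ (δ - 1) * u := by
        rw [Real.rpow_sub_one hu0.ne']; field_simp
      rw [e]
      have hw2 : z.re / 2 ≤ w.re := by
        have h1 := Complex.abs_re_le_norm (w - z)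
        rw [Metric.mem_ball, Complex.dist_eq] at hw
        have := (abs_le.mp (h1.trans hw.le)).1
        simp at this
        linarith
      have : Real.exp (-(w * u)).re ≤ Real.exp (-(z.re / 2) * u) := by
        simp only [Complex.neg_re, Complex.re_mul_ofReal]
        gcongr
        nlinarith
      have hp : 0 ≤ u ^ (δ - 1) * u := by positivity
      calc _ = (u ^ (δ - 1) * u) * Real.exp (-(w * u)).re := by ring
        _ ≤ _ := by gcongr
    · refine (Eventually.of_forall fun u w hw => ?_)
      have : HasDerivAt (fun w : ℂ => -(w * u)) (-(u:ℂ)) w := by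
        have h := ((hasDerivAt_id w).mul_const (u:ℂ)).neg
        rw [one_mul] at h
        exact h
      exact (this.cexp).const_mul _
  have hR : DifferentiableOn ℂ (fun z : ℂ => Complex.Gamma δ * z ^ ((-δ:ℝ):ℂ)) U := by
    intro z hz
    refine DifferentiableAt.differentiableWithinAt ?_
    exact (differentiableAt_id.cpow_const (Or.inl hz)).const_mul _
  have hpre : IsPreconnected U := (convex_halfSpace_re_gt 0).isPreconnected
  refine (hL.analyticOnNhd hUo).eqOn_of_preconnected_of_frequently_eq (hR.analyticOnNhd hUo) hpre
    (z₀ := 1) (by simp [hU]) ?_ hs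
  have hpos : ∀ x : ℝ, 0 < x → ∫ u in Ioi (0:ℝ), ((u ^ (δ - 1) : ℝ) : ℂ) * Complex.exp (-(x * u)) = Complex.Gamma δ * (x:ℂ) ^ ((-δ:ℝ):ℂ) := by
    intro x hx
    have := Complex.integral_cpow_mul_exp_neg_mul_Ioi (a := δ) (r := x) (by simpa using hδ) hx
    rw [mul_comm, one_div, Complex.inv_cpow _ _ (by rw [Complex.arg_ofReal_of_nonneg hx.le]; exact Real.pi_pos.ne), ← Complex.cpow_neg] at this
    rw [Complex.ofReal_neg, ← this]
    refine setIntegral_congr_fun measurableSet_Ioi fun u hu => ?_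
    rw [Complex.ofReal_cpow (le_of_lt hu)]
    push_cast; rfl
  have ht : Tendsto (fun n : ℕ => (((1 + 1 / ((n:ℝ) + 1) : ℝ)) : ℂ)) atTop (𝓝[≠] 1) := by
    rw [tendsto_nhdsWithin_iff]
    constructor
    · have := (tendsto_one_div_add_atTop_nhds_zero_nat (𝕜 := ℝ)).const_add 1
      have h := (Complex.continuous_ofReal.tendsto _).comp this
      rw [add_zero, Complex.ofReal_one] at h
      exact h
    · refine Eventually.of_forall fun n => ?_
      simp only [mem_compl_iff, mem_singleton_iff]
      rw [← Complex.ofReal_one, Complex.ofReal_inj]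
      have : 0 < 1 / ((n:ℝ) + 1) := by positivity
      linarith
  refine ht.frequently (Eventually.frequently (Eventually.of_forall fun n => ?_))
  exact hpos _ (by positivity)

lemma line_eq (f : ℂ → ℂ) (hf : Integrable (fun y : ℝ => f (1 + y * Complex.I))) :
    ctr f (π / 2) = Complex.I * ∫ y : ℝ, f (1 + y * Complex.I) := by
  have e1 : Complex.exp (((π / 2 : ℝ) : ℂ) * Complex.I) = Complex.I := by
    push_cast; exact Complex.exp_pi_div_two_mul_I
  have e2 : Complex.exp (((-(π / 2) : ℝ) : ℂ) * Complex.I) = -Complex.I := by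
    push_cast; rw [neg_mul, Complex.exp_neg, Complex.exp_pi_div_two_mul_I, Complex.inv_I]
  unfold ctr rayI
  rw [e1, e2]
  have h3 := integral_comp_neg_Ioi (0:ℝ) (fun y : ℝ => f (1 + y * Complex.I))
  rw [neg_zero] at h3
  rw [integral_mul_const, integral_mul_const, ← intervalIntegral.integral_Iic_add_Ioi (b := 0) hf.integrableOn hf.integrableOn, ← h3]
  simp only [Complex.ofReal_neg, neg_mul, mul_neg]
  ring

lemma hankel_line (ν : ℝ) (hν : 2 ≤ ν) (t : ℝ) (ht : 0 < t) :
    ctr (tE (fun s => s ^ ((-ν:ℝ):ℂ)) t) (π / 2) = 2 * π * Complex.I * ((t ^ (ν - 1) : ℝ) / Complex.Gamma ν) := by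
  have hpi := Real.pi_pos
  have hslit : ∀ y : ℝ, (1 + y * Complex.I) ∈ Complex.slitPlane := fun y => Or.inl (by simp)
  have hcont : Continuous (fun y : ℝ => (1 + y * Complex.I) ^ ((-ν:ℝ):ℂ)) := by
    refine continuous_iff_continuousAt.mpr fun y => ?_
    exact ContinuousAt.comp (f := fun y : ℝ => 1 + y * Complex.I) (g := fun s : ℂ => s ^ ((-ν:ℝ):ℂ)) (DifferentiableAt.continuousAt (𝕜 := ℂ) (differentiableAt_id.cpow_const (hslit y))) (by fun_prop)
  have hbd : ∀ y : ℝ, ‖(1 + y * Complex.I) ^ ((-ν:ℝ):ℂ)‖ ≤ (1 + y ^ 2)⁻¹ := by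
    intro y
    rw [Complex.norm_cpow_real]
    have hn : ‖1 + y * Complex.I‖ ^ 2 = 1 + y ^ 2 := by
      rw [Complex.sq_norm, Complex.normSq_apply]; simp; ring
    have h1 : 1 ≤ ‖1 + y * Complex.I‖ := by
      nlinarith [norm_nonneg (1 + y * Complex.I), sq_nonneg y]
    calc _ ≤ ‖1 + y * Complex.I‖ ^ (-2:ℝ) := Real.rpow_le_rpow_of_exponent_le h1 (by linarith)
      _ = _ := by rw [Real.rpow_neg (norm_nonneg _), ← hn]; norm_num
  have hint : Integrable (fun y : ℝ => (1 + y * Complex.I) ^ ((-ν:ℝ):ℂ)) :=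
    Integrable.mono' integrable_inv_one_add_sq hcont.aestronglyMeasurable (Eventually.of_forall hbd)
  have hint2 : Integrable (fun y : ℝ => tE (fun s => s ^ ((-ν:ℝ):ℂ)) t (1 + y * Complex.I)) := by
    unfold tE
    refine Integrable.bdd_mul (c := Real.exp t) hint (by fun_prop) (Eventually.of_forall fun y => ?_)
    rw [Complex.norm_exp]; simp
  rw [line_eq _ hint2]
  have hG : Complex.Gamma ν ≠ 0 := by
    rw [Complex.Gamma_ofReal]
    exact_mod_cast (Real.Gamma_pos_of_pos (by linarith)).ne'
  set f : ℝ → ℂ := (Ioi (0:ℝ)).indicator (fun u : ℝ => ((u ^ (ν - 1) : ℝ) : ℂ) * Complex.exp (-((1:ℂ) * u))) with hf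
  have hF : ∀ w : ℝ, FourierTransform.fourier f w = Complex.Gamma ν * (1 + ((2 * π * w : ℝ):ℂ) * Complex.I) ^ ((-ν:ℝ):ℂ) := by
    intro w
    rw [Real.fourier_real_eq_integral_exp_smul, ← lap_pow ν (by linarith) _ (by simp), ← integral_indicator measurableSet_Ioi]
    congr 1
    ext u
    by_cases hu : u ∈ Ioi (0:ℝ)
    · rw [hf, indicator_of_mem hu, indicator_of_mem hu, smul_eq_mul, mul_left_comm, ← Complex.exp_add]
      congr 2
      push_cast; ring
    · rw [hf, indicator_of_notMem hu, indicator_of_notMem hu, smul_zero]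
  have hfi : Integrable f := by
    rw [hf, integrable_indicator_iff measurableSet_Ioi]
    have := (integrableOn_rpow_mul_exp_neg_mul_rpow (p := 1) (s := ν - 1) (b := 1) (by linarith) one_pos one_pos)
    refine IntegrableOn.congr_fun (this.ofReal (𝕜 := ℂ)) (fun u hu => ?_) measurableSet_Ioi
    simp
  have hFi : Integrable (FourierTransform.fourier f) := by
    rw [show FourierTransform.fourier f = _ from funext hF]
    have := hint.comp_mul_left' (R := 2 * π) (by positivity)
    exact this.const_mul _
  have hfc : ContinuousAt f t := by
    have : f =ᶠ[𝓝 t] (fun u : ℝ => ((u ^ (ν - 1) : ℝ) : ℂ) * Complex.exp (-((1:ℂ) * u))) := by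
      filter_upwards [Ioi_mem_nhds ht] with u hu
      rw [hf, indicator_of_mem hu]
    refine ContinuousAt.congr ?_ this.symm
    refine ContinuousAt.mul ?_ (by fun_prop)
    exact Complex.continuous_ofReal.continuousAt.comp (Real.continuousAt_rpow_const t _ (Or.inl ht.ne'))
  have hinv := hfi.fourierInv_fourier_eq hFi hfc
  rw [Real.fourierInv_eq'] at hinv
  simp only [hF] at hinv
  have hsub := Measure.integral_comp_mul_left (fun y : ℝ => tE (fun s => s ^ ((-ν:ℝ):ℂ)) t (1 + y * Complex.I)) (2 * π)
  have hsub2 : ∫ w : ℝ, tE (fun s => s ^ ((-ν:ℝ):ℂ)) t (1 + ((2 * π * w : ℝ):ℂ) * Complex.I)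
     = Complex.exp t / Complex.Gamma ν * f t := by
    rw [← hinv, ← integral_const_mul]
    congr 1
    ext w
    rw [tE, smul_eq_mul, add_mul, one_mul, Complex.exp_add]
    have : Complex.exp (((2 * π * inner ℝ w t : ℝ):ℂ) * Complex.I) = Complex.exp (((2 * π * w : ℝ):ℂ) * Complex.I * t) := by
      congr 1; simp; ring
    rw [this]
    field_simp
  rw [hsub2, abs_of_pos (by positivity), Complex.real_smul, hf, indicator_of_mem (mem_Ioi.mpr ht), one_mul, Complex.exp_neg] at hsub
  have hexp := Complex.exp_ne_zero (t:ℂ)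
  have hpi' : (π:ℂ) ≠ 0 := by exact_mod_cast hpi.ne'
  generalize (∫ y : ℝ, tE (fun s => s ^ ((-ν:ℝ):ℂ)) t (1 + y * Complex.I)) = X at hsub ⊢
  push_cast at hsub ⊢
  field_simp at hsub ⊢
  linear_combination (-1 : ℂ) * hsub

lemma sub_lin (a K ε : ℝ) (ha : 0 < a) (ha1 : a < 1) (hK : 0 ≤ K) (hε : 0 < ε) :
    ∃ M, ∀ y ≥ (1:ℝ), K * y ^ a ≤ ε * y + M := by
  set Y := (K / ε) ^ (1 / (1 - a)) with hY
  refine ⟨K * Y ^ a, fun y hy => ?_⟩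
  have hy0 : 0 < y := by linarith
  have hKY : 0 ≤ K * Y ^ a := by positivity
  rcases le_total (K / ε) (y ^ (1 - a)) with h | h
  · rw [div_le_iff₀ hε] at h
    have e : y = y ^ (1 - a) * y ^ a := by
      rw [← Real.rpow_add hy0]; simp
    have : 0 < y ^ a := by positivity
    have : ε * y = (y ^ (1 - a) * ε) * y ^ a := by
      conv_lhs => rw [e]
      ring
    nlinarith
  · have : y ≤ Y := by
      have := Real.rpow_le_rpow (z := 1 / (1 - a)) (by positivity) h (one_div_nonneg.mpr (by linarith))
      rwa [← Real.rpow_mul hy0.le, mul_one_div_cancel (by linarith), Real.rpow_one] at this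
    have : K * y ^ a ≤ K * Y ^ a := by gcongr
    have : 0 < ε * y := by positivity
    linarith

lemma wedge_bd (a K p φ t : ℝ) (ha : 0 < a) (ha1 : a < 1) (hK : 0 ≤ K) (hφ : Real.cos φ < 0) (ht : 0 < t) :
    ∃ C ≥ 0, ∃ b > 0, ∀ r ≥ (0:ℝ), Real.exp ((1 + r * Real.cos φ) * t) * (1 + r) ^ p * Real.exp (K * (1 + r) ^ a)
      ≤ C * Real.exp (-b * r) := by
  set b := -Real.cos φ * t / 3 with hb
  have hb0 : 0 < b := by have := mul_pos_of_neg_of_neg hφ (neg_lt_zero.mpr ht); rw [hb]; linarith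
  obtain ⟨M, hM⟩ := sub_lin a K b ha ha1 hK hb0
  obtain ⟨C, hC, hCC⟩ := poly_exp 1 p b one_pos hb0
  refine ⟨C * Real.exp (t + M + 2 * b), by positivity, b, hb0, fun r hr => ?_⟩
  have h1 := hM (1 + r) (by linarith)
  have h2 := hCC (1 + r) (by linarith)
  rw [Real.rpow_one] at h2
  have e : Real.exp ((1 + r * Real.cos φ) * t) = Real.exp (-(b * (1 + r))) * Real.exp (t - 2 * b * r + b) := by
    rw [← Real.exp_add]; congr 1; rw [hb]; ring
  calc _ = ((1 + r) ^ p * Real.exp (-(b * (1 + r)))) * (Real.exp (t - 2 * b * r + b) * Real.exp (K * (1 + r) ^ a)) := by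
        rw [e]; ring
    _ ≤ C * (Real.exp (t - 2 * b * r + b) * Real.exp (b * (1 + r) + M)) := by gcongr
    _ = _ := by rw [← Real.exp_add, mul_assoc C (Real.exp (t + M + 2 * b)), ← Real.exp_add]; ring_nf

lemma pow_bd (θ₀ : ℝ) (hθ₀ : π / 2 ≤ θ₀) (hθ : θ₀ < π) (φ : ℝ) (hφ : φ ∈ Icc (-θ₀) θ₀) (hc : Real.cos φ < 0)
    (p t : ℝ) (ht : 0 < t) : ∃ C ≥ 0, ∃ b > 0, ∀ r ≥ (0:ℝ),
      ‖tE (fun s => s ^ (p:ℂ)) t (1 + (r:ℂ) * Complex.exp (φ * Complex.I))‖ ≤ C * Real.exp (-b * r) := by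
  obtain ⟨C, hC, h⟩ := pow_ray θ₀ hθ₀ hθ p
  obtain ⟨D, hD, b, hb, h'⟩ := wedge_bd (1/2) 0 p φ t (by norm_num) (by norm_num) le_rfl hc ht
  refine ⟨C * D, by positivity, b, hb, fun r hr => ?_⟩
  have h1 := h r hr φ hφ
  have h2 := h' r hr
  rw [zero_mul, Real.exp_zero, mul_one] at h2
  rw [tE, norm_mul, exp_norm]
  calc _ ≤ Real.exp ((1 + r * Real.cos φ) * t) * (C * (1 + r) ^ p) := by gcongr
    _ = C * (Real.exp ((1 + r * Real.cos φ) * t) * (1 + r) ^ p) := by ring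
    _ ≤ C * (D * Real.exp (-b * r)) := by gcongr
    _ = _ := by ring

lemma pow_diff (p : ℂ) (s : ℂ) (hs : s ∈ Complex.slitPlane) : DifferentiableAt ℂ (fun s : ℂ => s ^ p) s :=
  differentiableAt_id.cpow_const hs

lemma pow_int (θ₀ : ℝ) (hθ₀ : π / 2 ≤ θ₀) (hθ : θ₀ < π) (φ : ℝ) (hφ : φ ∈ Icc (-θ₀) θ₀) (hc : Real.cos φ < 0)
    (p t : ℝ) (ht : 0 < t) : IntegrableOn (fun r : ℝ =>
      tE (fun s => s ^ (p:ℂ)) t (1 + (r:ℂ) * Complex.exp (φ * Complex.I)) * Complex.exp (φ * Complex.I)) (Ioi 0) := by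
  obtain ⟨C, hC, b, hb, h⟩ := pow_bd θ₀ hθ₀ hθ φ hφ hc p t ht
  refine Integrable.mono' ((exp_neg_integrableOn_Ioi 0 hb).const_mul C) ?_ ?_
  · refine ContinuousOn.aestronglyMeasurable ?_ measurableSet_Ioi
    refine ContinuousOn.mul ?_ continuousOn_const
    exact (line_cont θ₀ hθ₀ hθ φ hφ _ (fun s hs => tE_diff t (pow_diff _ s hs))).mono Ioi_subset_Ici_self
  · refine (ae_restrict_iff' measurableSet_Ioi).mpr (Eventually.of_forall fun r hr => ?_)
    rw [norm_mul, Complex.norm_exp_ofReal_mul_I, mul_one]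
    exact h r (le_of_lt hr)

lemma ray_rec (θ₀ : ℝ) (hθ₀ : π / 2 ≤ θ₀) (hθ : θ₀ < π) (φ : ℝ) (hφ : φ ∈ Icc (-θ₀) θ₀) (hc : Real.cos φ < 0)
    (ν t : ℝ) (ht : 0 < t) :
    t * rayI (tE (fun s => s ^ ((-ν:ℝ):ℂ)) t) φ - ν * rayI (tE (fun s => s ^ ((-(ν+1):ℝ):ℂ)) t) φ = - Complex.exp t := by
  set e := Complex.exp (φ * Complex.I)
  have hi1 := (pow_int θ₀ hθ₀ hθ φ hφ hc (-ν) t ht).const_mul (t:ℂ)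
  have hi2 := (pow_int θ₀ hθ₀ hθ φ hφ hc (-(ν+1)) t ht).const_mul (ν:ℂ)
  have hd : ∀ r ∈ Ici (0:ℝ), HasDerivAt (fun r : ℝ => tE (fun s => s ^ ((-ν:ℝ):ℂ)) t (1 + (r:ℂ) * e))
      (t * (tE (fun s => s ^ ((-ν:ℝ):ℂ)) t (1 + (r:ℂ) * e) * e) - ν * (tE (fun s => s ^ ((-(ν+1):ℝ):ℂ)) t (1 + (r:ℂ) * e) * e)) r := by
    intro r hr
    have hs := slit_ray θ₀ hθ₀ hθ r hr φ hφ
    have h1 : HasDerivAt (fun r : ℝ => 1 + (r:ℂ) * e) e r := by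
      simpa using (((hasDerivAt_id r).ofReal_comp).mul_const e).const_add 1
    have h2 : HasDerivAt (fun s : ℂ => s ^ ((-ν:ℝ):ℂ)) (((-ν:ℝ):ℂ) * (1 + (r:ℂ) * e) ^ (((-ν:ℝ):ℂ) - 1) * 1) (1 + (r:ℂ) * e) :=
      (hasDerivAt_id _).cpow_const hs
    have h3 : HasDerivAt (fun s : ℂ => Complex.exp (s * t)) (Complex.exp ((1 + (r:ℂ) * e) * t) * (1 * t)) (1 + (r:ℂ) * e) :=
      ((hasDerivAt_id _).mul_const (t:ℂ)).cexp
    have h4 := (h3.mul h2).comp r h1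
    refine h4.congr_deriv ?_
    unfold tE
    have : (((-ν:ℝ):ℂ) - 1) = ((-(ν+1):ℝ):ℂ) := by push_cast; ring
    rw [this]
    push_cast
    ring
  have hlim : Tendsto (fun r : ℝ => tE (fun s => s ^ ((-ν:ℝ):ℂ)) t (1 + (r:ℂ) * e)) atTop (𝓝 0) := by
    obtain ⟨C, hC, b, hb, h⟩ := pow_bd θ₀ hθ₀ hθ φ hφ hc (-ν) t ht
    have hz : Tendsto (fun r : ℝ => C * Real.exp (-b * r)) atTop (𝓝 0) := by
      have := (Real.tendsto_exp_atBot.comp (tendsto_id.const_mul_atTop_of_neg (neg_lt_zero.mpr hb))).const_mul C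
      simpa using this
    refine squeeze_zero_norm' ?_ hz
    filter_upwards [eventually_ge_atTop 0] with r hr using h r hr
  have := integral_Ioi_of_hasDerivAt_of_tendsto (a := 0) (hd 0 self_mem_Ici).continuousAt.continuousWithinAt
    (fun r hr => hd r (Ioi_subset_Ici_self hr)) (hi1.sub hi2) hlim
  rw [integral_sub hi1 hi2, integral_const_mul, integral_const_mul] at this
  unfold rayI
  rw [this]
  simp [tE]

lemma cos_sym {θ₀ φ : ℝ} (h : φ = θ₀ ∨ φ = -θ₀) : Real.cos φ = Real.cos θ₀ := by
  rcases h with rfl | rfl <;> simp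

lemma hankel (θ₀ : ℝ) (hθ₀ : π / 2 < θ₀) (hθ : θ₀ < π) (t : ℝ) (ht : 0 < t) (ν : ℝ) :
    ctr (tE (fun s => s ^ ((-ν:ℝ):ℂ)) t) θ₀ = 2 * π * Complex.I * ((t ^ (ν - 1) : ℝ) / Complex.Gamma ν) := by
  have hpi := Real.pi_pos
  have hc : Real.cos θ₀ < 0 := Real.cos_neg_of_pi_div_two_lt_of_lt hθ₀ (by linarith)
  have main : ∀ n : ℕ, ∀ ν : ℝ, 2 - n ≤ ν → ctr (tE (fun s => s ^ ((-ν:ℝ):ℂ)) t) θ₀ = 2 * π * Complex.I * ((t ^ (ν - 1) : ℝ) / Complex.Gamma ν) := by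
    intro n
    induction n with
    | zero =>
      intro ν hν
      have hν' : 2 ≤ ν := by simpa using hν
      rw [← hankel_line ν hν' t ht]
      exact (ctr_rotate θ₀ hθ₀.le hθ _ (nice_pow θ₀ hθ₀.le hθ ν hν') t ht.le).symm
    | succ n ih =>
      intro ν hν
      push_cast at hν
      have h1 := ih (ν + 1) (by linarith)
      have r1 := ray_rec θ₀ hθ₀.le hθ θ₀ ⟨by linarith, le_rfl⟩ hc ν t ht
      have r2 := ray_rec θ₀ hθ₀.le hθ (-θ₀) ⟨le_rfl, by linarith⟩ (by rwa [Real.cos_neg]) ν t ht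
      have ht' : (t:ℂ) ≠ 0 := by exact_mod_cast ht.ne'
      have h2 : t * ctr (tE (fun s => s ^ ((-ν:ℝ):ℂ)) t) θ₀ = ν * ctr (tE (fun s => s ^ ((-(ν+1):ℝ):ℂ)) t) θ₀ := by
        unfold ctr
        linear_combination r1 - r2
      have h3 : (1:ℂ) / Complex.Gamma ν = ν / Complex.Gamma (ν + 1) := by
        rw [one_div, Complex.one_div_Gamma_eq_self_mul_one_div_Gamma_add_one]; rfl
      have h4 : t ^ (ν + 1 - 1) = t * t ^ (ν - 1) := by
        rw [add_sub_cancel_right, Real.rpow_sub_one ht.ne']; field_simp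
      rw [h1, h4] at h2
      have h5 : ((t ^ (ν - 1) : ℝ) : ℂ) / Complex.Gamma ν = (t ^ (ν - 1) : ℝ) * (1 / Complex.Gamma ν) := by ring
      rw [h5, h3]
      apply mul_left_cancel₀ ht'
      rw [h2]
      push_cast
      ring
  obtain ⟨n, hn⟩ := exists_nat_ge (2 - ν)
  exact main n ν (by linarith)

lemma hs_congr {f g : ℕ → ℂ} {a : ℂ} (h : ∀ n, f n = g n) (hg : HasSum g a) : HasSum f a := by
  rwa [funext h]

lemma cpow_split (s : ℂ) (hs : s ≠ 0) (a μ : ℝ) (n : ℕ) :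
    s ^ ((-(μ - a * n) : ℝ) : ℂ) = s ^ ((-μ : ℝ) : ℂ) * (s ^ (a:ℂ)) ^ n := by
  rw [← Complex.cpow_mul_nat, ← Complex.cpow_add _ _ hs]
  congr 1
  push_cast; ring

lemma ray_sum (a θ₀ : ℝ) (ha : 0 < a) (ha1 : a < 1) (hθ₀ : π / 2 ≤ θ₀) (hθ : θ₀ < π) (φ : ℝ) (hφ : φ ∈ Icc (-θ₀) θ₀) (hc : Real.cos φ < 0)
    (μ t : ℝ) (ht : 0 < t) (c : ℂ) :
    HasSum (fun n : ℕ => (-c) ^ n / (n.factorial : ℂ) * rayI (tE (fun s => s ^ ((-(μ - a * n) : ℝ) : ℂ)) t) φ)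
      (rayI (tE (wker a μ c) t) φ) := by
  unfold rayI
  simp only [← integral_const_mul]
  obtain ⟨C, hC, hp⟩ := pow_ray θ₀ hθ₀ hθ (-μ)
  obtain ⟨D, hD, b, hb, hw⟩ := wedge_bd a ‖c‖ (-μ) φ t ha ha1 (norm_nonneg _) hc ht
  have hbs : ∀ r : ℝ, HasSum (fun n : ℕ => Real.exp ((1 + r * Real.cos φ) * t) * (C * (1 + r) ^ (-μ)) * ((‖c‖ * (1 + r) ^ a) ^ n / (n.factorial : ℝ)))
      (Real.exp ((1 + r * Real.cos φ) * t) * (C * (1 + r) ^ (-μ)) * Real.exp (‖c‖ * (1 + r) ^ a)) := by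
    intro r
    have := NormedSpace.expSeries_div_hasSum_exp (‖c‖ * (1 + r) ^ a)
    rw [← Real.exp_eq_exp_ℝ] at this
    exact this.mul_left _
  refine hasSum_integral_of_dominated_convergence
    (fun n r => Real.exp ((1 + r * Real.cos φ) * t) * (C * (1 + r) ^ (-μ)) * ((‖c‖ * (1 + r) ^ a) ^ n / (n.factorial : ℝ))) ?_ ?_ ?_ ?_ ?_
  · intro n
    exact ((pow_int θ₀ hθ₀ hθ φ hφ hc _ t ht).const_mul _).aestronglyMeasurable
  · intro n
    refine (ae_restrict_iff' measurableSet_Ioi).mpr (Eventually.of_forall fun r hr => ?_)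
    have hr0 : 0 ≤ r := le_of_lt hr
    have hs0 := (arg_le θ₀ hθ₀ hθ r hr0 φ hφ).1
    have h1 := hp r hr0 φ hφ
    have h2 := norm_le_ray r φ hr0
    have he := exp_norm t r φ
    set s := 1 + (r:ℂ) * Complex.exp (φ * Complex.I)
    rw [norm_mul, norm_mul, norm_div, norm_pow, norm_neg, Complex.norm_exp_ofReal_mul_I, mul_one, tE,
      norm_mul, he, cpow_split s hs0, norm_mul, norm_pow, Complex.norm_cpow_real s a, Complex.norm_natCast]
    have h3 : ‖s‖ ^ a ≤ (1 + r) ^ a := by gcongr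
    calc _ = Real.exp ((1 + r * Real.cos φ) * t) * ‖s ^ ((-μ:ℝ):ℂ)‖ * ((‖c‖ * ‖s‖ ^ a) ^ n / n.factorial) := by
          rw [mul_pow]; ring
      _ ≤ _ := by gcongr
  · exact Eventually.of_forall fun r => (hbs r).summable
  · simp only [fun r => (hbs r).tsum_eq]
    refine Integrable.mono' ((exp_neg_integrableOn_Ioi 0 hb).const_mul (C * D)) ?_ ?_
    · refine ContinuousOn.aestronglyMeasurable ?_ measurableSet_Ioi
      have hh : ∀ p : ℝ, ContinuousOn (fun r : ℝ => (1 + r) ^ p) (Ioi 0) := by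
        intro p r hr
        refine ContinuousAt.continuousWithinAt ?_
        have hr' : 0 < r := hr
        exact ContinuousAt.rpow_const (by fun_prop) (Or.inl (by positivity))
      have h1 := hh (-μ)
      have h2 := hh a
      fun_prop
    · refine (ae_restrict_iff' measurableSet_Ioi).mpr (Eventually.of_forall fun r hr => ?_)
      have hr0 : 0 < r := hr
      have := hw r hr0.le
      rw [Real.norm_of_nonneg (by positivity)]
      calc _ = C * (Real.exp ((1 + r * Real.cos φ) * t) * (1 + r) ^ (-μ) * Real.exp (‖c‖ * (1 + r) ^ a)) := by ring
        _ ≤ C * (D * Real.exp (-b * r)) := by gcongr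
        _ = _ := by ring
  · refine (ae_restrict_iff' measurableSet_Ioi).mpr (Eventually.of_forall fun r hr => ?_)
    have hr0 : 0 ≤ r := le_of_lt hr
    have hs0 := (arg_le θ₀ hθ₀ hθ r hr0 φ hφ).1
    set s := 1 + (r:ℂ) * Complex.exp (φ * Complex.I)
    have := NormedSpace.expSeries_div_hasSum_exp (-(c * s ^ (a:ℂ)))
    rw [← Complex.exp_eq_exp_ℂ] at this
    have := this.mul_left (Complex.exp (s * t) * s ^ ((-μ:ℝ):ℂ) * Complex.exp (φ * Complex.I))
    have e1 : tE (wker a μ c) t s * Complex.exp (φ * Complex.I) = Complex.exp (s * t) * s ^ ((-μ:ℝ):ℂ) * Complex.exp (φ * Complex.I) * Complex.exp (-(c * s ^ (a:ℂ))) := by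
      simp only [tE, wker]; ring
    rw [e1]
    refine hs_congr (fun n => ?_) this
    simp only [tE]
    rw [cpow_split s hs0, ← neg_mul, mul_pow]
    ring

lemma exists_theta (α : ℝ) (hα0 : 0 < α) (hα1 : α < 1) : ∃ θ₀, π / 2 < θ₀ ∧ θ₀ < π ∧ (α / 3) * θ₀ < π / 6 := by
  have hpi := Real.pi_pos
  have h1 : π / 2 < min π (π / (2 * α)) := by
    rw [lt_min_iff]
    refine ⟨by linarith, ?_⟩
    rw [div_lt_div_iff₀ (by norm_num) (by positivity)]
    nlinarith
  obtain ⟨θ, h2, h3⟩ := exists_between h1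
  rw [lt_min_iff, lt_div_iff₀ (by positivity)] at h3
  exact ⟨θ, h2, h3.1, by linarith [h3.2]⟩

lemma ctr_sum (a θ₀ : ℝ) (ha : 0 < a) (ha1 : a < 1) (hθ₀ : π / 2 < θ₀) (hθ : θ₀ < π)
    (μ t : ℝ) (ht : 0 < t) (c : ℂ) :
    HasSum (fun n : ℕ => 2 * π * Complex.I * (t ^ (μ - 1) : ℝ) * ((-c / ((t ^ a : ℝ) : ℂ)) ^ n / ((n.factorial : ℂ) * Complex.Gamma (-(a:ℂ) * n + μ))))
      (ctr (tE (wker a μ c) t) θ₀) := by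
  have hpi := Real.pi_pos
  have hc : Real.cos θ₀ < 0 := Real.cos_neg_of_pi_div_two_lt_of_lt hθ₀ (by linarith)
  have h1 := ray_sum a θ₀ ha ha1 hθ₀.le hθ θ₀ ⟨by linarith, le_rfl⟩ hc μ t ht c
  have h2 := ray_sum a θ₀ ha ha1 hθ₀.le hθ (-θ₀) ⟨le_rfl, by linarith⟩ (by rwa [Real.cos_neg]) μ t ht c
  refine hs_congr (fun n => ?_) (h1.sub h2)
  rw [← mul_sub]
  have := hankel θ₀ hθ₀ hθ t ht (μ - a * n)
  unfold ctr at this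
  rw [this]
  have e1 : t ^ (μ - a * n - 1) = t ^ (μ - 1) / (t ^ a) ^ n := by
    rw [← Real.rpow_natCast (t ^ a), ← Real.rpow_mul ht.le, ← Real.rpow_sub ht]; ring_nf
  rw [e1]
  have e2 : (((μ - a * n : ℝ)) : ℂ) = -(a:ℂ) * n + μ := by push_cast; ring
  rw [e2, div_pow]
  push_cast
  ring

lemma wright_summable (a : ℝ) (ha : 0 < a) (ha1 : a < 1) (μ : ℝ) (z : ℂ) :
    Summable (fun n : ℕ => z ^ n / ((n.factorial : ℂ) * Complex.Gamma (-(a:ℂ) * n + μ))) := by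
  have hpi := Real.pi_pos
  have h := (ctr_sum a (3 * π / 4) ha ha1 (by linarith) (by linarith) μ 1 one_pos (-z)).summable
  have h2 := h.mul_left ((2 * π * Complex.I)⁻¹)
  refine h2.congr fun n => ?_
  have hpi' : (π:ℂ) ≠ 0 := by exact_mod_cast hpi.ne'
  have hne : (2 * π * Complex.I : ℂ) ≠ 0 := by simp [hpi', Complex.I_ne_zero]
  simp only [Real.one_rpow, Complex.ofReal_one, mul_one, neg_neg, div_one]
  rw [inv_mul_cancel_left₀ hne]

lemma wright_ctr (a θ₀ : ℝ) (ha : 0 < a) (ha1 : a < 1) (hθ₀ : π / 2 < θ₀) (hθ : θ₀ < π)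
    (μ t : ℝ) (ht : 0 < t) (c : ℂ) (hc : GoodC a θ₀ c) :
    ctr (tE (wker a μ c) t) (π / 2) =
      2 * π * Complex.I * ((t ^ (μ - 1) : ℝ) * wrightPhi (-(a:ℂ)) μ (-c / ((t ^ a : ℝ) : ℂ))) := by
  rw [ctr_rotate θ₀ hθ₀.le hθ _ (nice_wker a θ₀ ha hθ₀.le hθ c hc μ) t ht.le,
    ← (ctr_sum a θ₀ ha ha1 hθ₀ hθ μ t ht c).tsum_eq, tsum_mul_left, wrightPhi]
  ring

lemma ray_fub (θ₀ : ℝ) (hθ₀ : π / 2 ≤ θ₀) (hθ : θ₀ < π) (φ : ℝ) (hφ : φ ∈ Icc (-θ₀) θ₀) (hcos : Real.cos φ = 0)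
    (g : ℂ → ℂ) (hg : Nice θ₀ g) (δ : ℝ) (hδ : 0 < δ) (t : ℝ) :
    IntegrableOn (fun u : ℝ => ((u ^ (δ - 1) : ℝ) : ℂ) * rayI (tE g (t - u)) φ) (Ioi 0) ∧
    ∫ u in Ioi (0:ℝ), ((u ^ (δ - 1) : ℝ) : ℂ) * rayI (tE g (t - u)) φ
      = Complex.Gamma δ * rayI (tE (fun s => s ^ ((-δ:ℝ):ℂ) * g s) t) φ := by
  obtain ⟨hd, C, hC, hb⟩ := hg
  set S : ℝ → ℂ := fun r => 1 + (r:ℂ) * Complex.exp (φ * Complex.I) with hS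
  set E := Complex.exp (φ * Complex.I) with hE
  have hEn : ‖E‖ = 1 := Complex.norm_exp_ofReal_mul_I φ
  set H : ℝ → ℝ → ℂ := fun u r => ((u ^ (δ - 1) : ℝ) : ℂ) * Complex.exp (-(S r * u)) * (Complex.exp (S r * t) * g (S r) * E) with hH
  have hSre : ∀ r, (S r).re = 1 := by
    intro r
    simp [hS, hE, Complex.exp_ofReal_mul_I_re, hcos]
  have hgc : ContinuousOn (fun r : ℝ => g (S r)) (Ici 0) := line_cont θ₀ hθ₀ hθ φ hφ g hd
  have hint : Integrable (Function.uncurry H) ((volume.restrict (Ioi (0:ℝ))).prod (volume.restrict (Ioi (0:ℝ)))) := by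
    have hA : Integrable (fun u : ℝ => Real.exp (-u) * u ^ (δ - 1)) (volume.restrict (Ioi (0:ℝ))) := Real.GammaIntegral_convergent hδ
    have hB := int_base.const_mul (Real.exp t * C)
    refine Integrable.mono' (hA.mul_prod hB) ?_ ?_
    · rw [Measure.prod_restrict]
      refine ContinuousOn.aestronglyMeasurable ?_ (measurableSet_Ioi.prod measurableSet_Ioi)
      have h1 : ContinuousOn (fun p : ℝ × ℝ => ((p.1 ^ (δ - 1) : ℝ) : ℂ)) (Ioi 0 ×ˢ Ioi 0) := by
        refine Complex.continuous_ofReal.comp_continuousOn ?_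
        refine ContinuousOn.rpow_const continuousOn_fst fun p hp => Or.inl (ne_of_gt hp.1)
      have h2 : ContinuousOn (fun p : ℝ × ℝ => g (S p.2)) (Ioi 0 ×ˢ Ioi 0) :=
        hgc.comp continuousOn_snd fun p hp => Ioi_subset_Ici_self hp.2
      have h3 : Continuous S := by simp only [hS]; fun_prop
      have h4 : ContinuousOn (fun p : ℝ × ℝ => Complex.exp (-(S p.2 * p.1))) (Ioi 0 ×ˢ Ioi 0) := by
        fun_prop
      have h5 : ContinuousOn (fun p : ℝ × ℝ => Complex.exp (S p.2 * t)) (Ioi 0 ×ˢ Ioi 0) := by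
        fun_prop
      exact (h1.mul h4).mul ((h5.mul h2).mul continuousOn_const)
    · rw [Measure.prod_restrict]
      refine (ae_restrict_iff' (measurableSet_Ioi.prod measurableSet_Ioi)).mpr (Eventually.of_forall fun p hp => ?_)
      have hu : 0 < p.1 := hp.1
      have hr : 0 < p.2 := hp.2
      have h1 := hb p.2 hr.le φ hφ
      simp only [Function.uncurry, hH]
      rw [norm_mul, norm_mul, norm_mul, norm_mul, hEn, mul_one, Complex.norm_exp, Complex.norm_exp, Complex.norm_real,
        Real.norm_of_nonneg (by positivity), Complex.neg_re, Complex.re_mul_ofReal, Complex.re_mul_ofReal, hSre, one_mul, one_mul]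
      calc _ ≤ p.1 ^ (δ - 1) * Real.exp (-p.1) * (Real.exp t * (C * (1 + p.2) ^ (-2:ℝ))) := by gcongr
        _ = _ := by ring
  have e1 : ∀ u : ℝ, ∫ r in Ioi (0:ℝ), H u r = ((u ^ (δ - 1) : ℝ) : ℂ) * rayI (tE g (t - u)) φ := by
    intro u
    rw [rayI, ← integral_const_mul]
    refine integral_congr_ae (Eventually.of_forall fun r => ?_)
    simp only [hH, tE]
    have : Complex.exp (S r * ((t - u : ℝ) : ℂ)) = Complex.exp (-(S r * u)) * Complex.exp (S r * t) := by
      rw [← Complex.exp_add]; congr 1; push_cast; ring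
    change _ = _ * (Complex.exp (S r * ((t - u : ℝ) : ℂ)) * g (S r) * E)
    rw [this]; ring
  have e2 : ∀ r : ℝ, ∫ u in Ioi (0:ℝ), H u r = Complex.Gamma δ * (tE (fun s => s ^ ((-δ:ℝ):ℂ) * g s) t (S r) * E) := by
    intro r
    simp only [hH]
    rw [integral_mul_const, lap_pow δ hδ (S r) (by rw [hSre]; norm_num)]
    simp only [tE]; ring
  constructor
  · have := hint.integral_prod_left
    simp only [Function.uncurry, e1] at this
    exact this
  · have := integral_integral_swap hint
    simp only [e1, e2] at this
    rw [this, integral_const_mul]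
    rfl

lemma ctr_fub (a θ₀ : ℝ) (ha : 0 < a) (hθ₀ : π / 2 ≤ θ₀) (hθ : θ₀ < π) (c : ℂ) (hc : GoodC a θ₀ c) (μ δ : ℝ) (hδ : 0 < δ) (t : ℝ) :
    IntegrableOn (fun u : ℝ => ((u ^ (δ - 1) : ℝ) : ℂ) * ctr (tE (wker a μ c) (t - u)) (π / 2)) (Ioi 0) ∧
    ∫ u in Ioi (0:ℝ), ((u ^ (δ - 1) : ℝ) : ℂ) * ctr (tE (wker a μ c) (t - u)) (π / 2)
      = Complex.Gamma δ * ctr (tE (wker a (μ + δ) c) t) (π / 2) := by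
  have hpi := Real.pi_pos
  have hn := nice_wker a θ₀ ha hθ₀ hθ c hc μ
  have m1 : (π / 2) ∈ Icc (-θ₀) θ₀ := ⟨by linarith, hθ₀⟩
  have m2 : (-(π / 2)) ∈ Icc (-θ₀) θ₀ := ⟨by linarith, by linarith⟩
  obtain ⟨i1, h1⟩ := ray_fub θ₀ hθ₀ hθ (π / 2) m1 (by simp) _ hn δ hδ t
  obtain ⟨i2, h2⟩ := ray_fub θ₀ hθ₀ hθ (-(π / 2)) m2 (by simp) _ hn δ hδ t
  have key : ∀ φ ∈ Icc (-θ₀) θ₀, rayI (tE (fun s => s ^ ((-δ:ℝ):ℂ) * wker a μ c s) t) φ = rayI (tE (wker a (μ + δ) c) t) φ := by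
    intro φ hφ
    unfold rayI
    refine setIntegral_congr_fun measurableSet_Ioi fun r hr => ?_
    have hs0 := (arg_le θ₀ hθ₀ hθ r (le_of_lt hr) φ hφ).1
    simp only [tE, wker]
    have : ((-(μ + δ) : ℝ) : ℂ) = ((-δ:ℝ):ℂ) + ((-μ:ℝ):ℂ) := by push_cast; ring
    rw [this, Complex.cpow_add _ _ hs0]
    ring
  rw [key _ m1] at h1
  rw [key _ m2] at h2
  have e : ∀ u : ℝ, ((u ^ (δ - 1) : ℝ) : ℂ) * ctr (tE (wker a μ c) (t - u)) (π / 2) =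
    ((u ^ (δ - 1) : ℝ) : ℂ) * rayI (tE (wker a μ c) (t - u)) (π / 2) - ((u ^ (δ - 1) : ℝ) : ℂ) * rayI (tE (wker a μ c) (t - u)) (-(π / 2)) := by
    intro u; rw [ctr, mul_sub]
  simp only [e]
  refine ⟨i1.sub i2, ?_⟩
  rw [integral_sub i1 i2, h1, h2, ctr, mul_sub]

lemma wright_J (a θ₀ : ℝ) (ha : 0 < a) (ha1 : a < 1) (hθ₀ : π / 2 < θ₀) (hθ : θ₀ < π) (c : ℂ) (hc : GoodC a θ₀ c) (μ δ : ℝ) (hδ : 0 < δ) (t : ℝ) (ht : 0 < t) :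
    IntervalIntegrable (fun ξ : ℝ => (((ξ ^ (μ - 1) : ℝ) : ℂ) * wrightPhi (-(a:ℂ)) μ (-c / ((ξ ^ a : ℝ) : ℂ))) * (((t - ξ) ^ (δ - 1) : ℝ) : ℂ)) volume 0 t ∧
    ∫ ξ in (0:ℝ)..t, (((ξ ^ (μ - 1) : ℝ) : ℂ) * wrightPhi (-(a:ℂ)) μ (-c / ((ξ ^ a : ℝ) : ℂ))) * (((t - ξ) ^ (δ - 1) : ℝ) : ℂ)
      = Complex.Gamma δ * (((t ^ (μ + δ - 1) : ℝ) : ℂ) * wrightPhi (-(a:ℂ)) ((μ + δ : ℝ) : ℂ) (-c / ((t ^ a : ℝ) : ℂ))) := by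
  have hpi' : (π:ℂ) ≠ 0 := by exact_mod_cast Real.pi_pos.ne'
  have hne : (2 * π * Complex.I : ℂ) ≠ 0 := by simp [hpi', Complex.I_ne_zero]
  obtain ⟨i1, h1⟩ := ctr_fub a θ₀ ha hθ₀.le hθ c hc μ δ hδ t
  have hz : ∀ u ∈ Ioi (0:ℝ) \ Ioc 0 t, ((u ^ (δ - 1) : ℝ) : ℂ) * ctr (tE (wker a μ c) (t - u)) (π / 2) = 0 := by
    intro u hu
    have : t < u := by
      by_contra h
      exact hu.2 ⟨hu.1, not_lt.mp h⟩
    rw [ctr_zero θ₀ hθ₀.le hθ _ (nice_wker a θ₀ ha hθ₀.le hθ c hc μ) _ (by linarith), mul_zero]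
  rw [setIntegral_eq_of_subset_of_forall_sdiff_eq_zero measurableSet_Ioi Ioc_subset_Ioi_self hz,
    ← intervalIntegral.integral_of_le ht.le, wright_ctr a θ₀ ha ha1 hθ₀ hθ (μ + δ) t ht c hc] at h1
  have i2 : IntervalIntegrable (fun u : ℝ => ((u ^ (δ - 1) : ℝ) : ℂ) * ctr (tE (wker a μ c) (t - u)) (π / 2)) volume 0 t := by
    rw [intervalIntegrable_iff_integrableOn_Ioc_of_le ht.le]
    exact i1.mono_set Ioc_subset_Ioi_self
  have i3 := (i2.comp_sub_left t).symm
  simp only [sub_zero, sub_self] at i3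
  have h3 := intervalIntegral.integral_comp_sub_left (a := 0) (b := t) (fun u : ℝ => ((u ^ (δ - 1) : ℝ) : ℂ) * ctr (tE (wker a μ c) (t - u)) (π / 2)) t
  simp only [sub_zero, sub_self] at h3
  rw [h1] at h3
  have hcongr : ∀ ξ ∈ Ioc 0 t, (2 * π * Complex.I : ℂ)⁻¹ * ((((t - ξ) ^ (δ - 1) : ℝ) : ℂ) * ctr (tE (wker a μ c) (t - (t - ξ))) (π / 2)) =
      (((ξ ^ (μ - 1) : ℝ) : ℂ) * wrightPhi (-(a:ℂ)) μ (-c / ((ξ ^ a : ℝ) : ℂ))) * (((t - ξ) ^ (δ - 1) : ℝ) : ℂ) := by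
    intro ξ hξ
    rw [sub_sub_cancel, wright_ctr a θ₀ ha ha1 hθ₀ hθ μ ξ hξ.1 c hc]
    generalize wrightPhi _ _ _ = W
    field_simp
  constructor
  · refine (i3.const_mul ((2 * π * Complex.I : ℂ)⁻¹)).congr ?_
    rw [uIoc_of_le ht.le]
    intro ξ hξ
    exact hcongr ξ hξ
  · have : ∫ ξ in (0:ℝ)..t, (((ξ ^ (μ - 1) : ℝ) : ℂ) * wrightPhi (-(a:ℂ)) μ (-c / ((ξ ^ a : ℝ) : ℂ))) * (((t - ξ) ^ (δ - 1) : ℝ) : ℂ) =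
      ∫ ξ in (0:ℝ)..t, (2 * π * Complex.I : ℂ)⁻¹ * ((((t - ξ) ^ (δ - 1) : ℝ) : ℂ) * ctr (tE (wker a μ c) (t - (t - ξ))) (π / 2)) := by
      refine intervalIntegral.integral_congr_ae (Eventually.of_forall fun ξ hξ => ?_)
      rw [uIoc_of_le ht.le] at hξ
      exact (hcongr ξ hξ).symm
    rw [this, intervalIntegral.integral_const_mul, h3]
    generalize wrightPhi _ _ _ = W
    field_simp

lemma wright_deriv (a : ℝ) (ha : 0 < a) (ha1 : a < 1) (μ : ℝ) (z : ℂ) :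
    HasDerivAt (wrightPhi (-(a:ℂ)) μ) (wrightPhi (-(a:ℂ)) ((μ - a : ℝ) : ℂ) z) z := by
  have hterm : ∀ (y : ℂ) (n : ℕ), ((n + 1 : ℕ) : ℂ) * y ^ n / (((n + 1).factorial : ℂ) * Complex.Gamma (-(a:ℂ) * ((n + 1 : ℕ) : ℂ) + μ))
      = y ^ n / ((n.factorial : ℂ) * Complex.Gamma (-(a:ℂ) * n + ((μ - a : ℝ) : ℂ))) := by
    intro y n
    have e : -(a:ℂ) * ((n + 1 : ℕ) : ℂ) + μ = -(a:ℂ) * n + ((μ - a : ℝ) : ℂ) := by push_cast; ring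
    rw [e, Nat.factorial_succ, Nat.cast_mul, mul_assoc, mul_div_mul_left]
    exact Nat.cast_ne_zero.mpr (Nat.succ_ne_zero n)
  set R : ℝ := ‖z‖ + 1
  have hR : 0 < R := by positivity
  set g' : ℕ → ℂ → ℂ := fun n y => (n:ℂ) * y ^ (n - 1) / ((n.factorial : ℂ) * Complex.Gamma (-(a:ℂ) * n + μ)) with hg'
  have hsum : Summable (fun n => ‖g' n (R:ℂ)‖) := by
    rw [← summable_nat_add_iff 1]
    refine (wright_summable a ha ha1 (μ - a) (R:ℂ)).norm.congr fun n => ?_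
    simp only [hg', Nat.add_sub_cancel]
    rw [hterm]
  have hsz : Summable (fun n => g' n z) := by
    rw [← summable_nat_add_iff 1]
    refine (wright_summable a ha ha1 (μ - a) z).congr fun n => ?_
    simp only [hg', Nat.add_sub_cancel]
    rw [hterm]
  have hz : z ∈ Metric.ball (0:ℂ) R := by simp [R]
  have := hasDerivAt_tsum_of_isPreconnected (g := fun (n : ℕ) (z : ℂ) => z ^ n / ((n.factorial : ℂ) * Complex.Gamma (-(a:ℂ) * n + μ)))
    (g' := g') hsum Metric.isOpen_ball (convex_ball (0:ℂ) R).isPreconnected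
    (fun n y _ => by
      exact (hasDerivAt_pow n y).div_const _)
    (fun n y hy => by
      have hy' : ‖y‖ ≤ R := by simpa using (mem_ball_zero_iff.mp hy).le
      simp only [hg', norm_div, norm_mul, norm_pow, Complex.norm_real, Real.norm_of_nonneg hR.le]
      gcongr) hz (wright_summable a ha ha1 μ z) hz
  have e : ∑' n, g' n z = wrightPhi (-(a:ℂ)) ((μ - a : ℝ) : ℂ) z := by
    rw [hsz.tsum_eq_zero_add, wrightPhi]
    have : g' 0 z = 0 := by simp [hg']
    rw [this, zero_add]
    refine tsum_congr fun n => ?_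
    simp only [hg', Nat.add_sub_cancel]
    rw [hterm]
  rw [e] at this
  exact this

noncomputable def wre (a μ : ℝ) (K w : ℂ) (y : ℝ) : ℝ := (K * wrightPhi (-(a:ℂ)) μ (w * y)).re

lemma wre_deriv (a : ℝ) (ha : 0 < a) (ha1 : a < 1) (μ : ℝ) (K w : ℂ) :
    deriv (wre a μ K w) = wre a (μ - a) (K * w) w := by
  ext y
  refine HasDerivAt.deriv ?_
  have h1 : HasDerivAt (fun z : ℂ => K * wrightPhi (-(a:ℂ)) μ (w * z)) (K * w * wrightPhi (-(a:ℂ)) ((μ - a : ℝ) : ℂ) (w * y)) (y:ℂ) := by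
    have h2 : HasDerivAt (fun z : ℂ => w * z) w (y:ℂ) := by simpa using (hasDerivAt_id (y:ℂ)).const_mul w
    have h3 := ((wright_deriv a ha ha1 μ (w * y)).comp (y:ℂ) h2).const_mul K
    have e : K * w * wrightPhi (-(a:ℂ)) ((μ - a : ℝ) : ℂ) (w * y) = K * (wrightPhi (-(a:ℂ)) ((μ - a : ℝ) : ℂ) (w * y) * w) := by ring
    rw [e]
    exact h3
  exact h1.real_of_complex

lemma wre_deriv3 (a : ℝ) (ha : 0 < a) (ha1 : a < 1) (μ : ℝ) (K w : ℂ) (x : ℝ) (f : ℝ → ℝ) (hf : f =ᶠ[𝓝 x] wre a μ K w) :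
    deriv (deriv (deriv f)) x = wre a (μ - 3 * a) (K * w ^ 3) w x := by
  rw [hf.deriv.deriv.deriv_eq, wre_deriv a ha ha1, wre_deriv a ha ha1, wre_deriv a ha ha1]
  congr 1 <;> ring

lemma wright_J_re (a θ₀ : ℝ) (ha : 0 < a) (ha1 : a < 1) (hθ₀ : π / 2 < θ₀) (hθ : θ₀ < π) (c : ℂ) (hc : GoodC a θ₀ c) (μ δ : ℝ) (hδ : 0 < δ) (t : ℝ) (ht : 0 < t)
    (K : ℂ) (f : ℝ → ℝ) (hf : ∀ ξ, f ξ = (K * (((ξ ^ (μ - 1) : ℝ) : ℂ) * wrightPhi (-(a:ℂ)) μ (-c / ((ξ ^ a : ℝ) : ℂ)))).re) :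
    fracJ δ f t = (K * (((t ^ (μ + δ - 1) : ℝ) : ℂ) * wrightPhi (-(a:ℂ)) ((μ + δ : ℝ) : ℂ) (-c / ((t ^ a : ℝ) : ℂ)))).re := by
  obtain ⟨i, h⟩ := wright_J a θ₀ ha ha1 hθ₀ hθ c hc μ δ hδ t ht
  have hG : Real.Gamma δ ≠ 0 := (Real.Gamma_pos_of_pos hδ).ne'
  have h2 := Complex.reCLM.intervalIntegral_comp_comm (i.const_mul K)
  rw [intervalIntegral.integral_const_mul, h, Complex.Gamma_ofReal] at h2
  simp only [Complex.reCLM_apply] at h2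
  have e : ∀ ξ, f ξ * (t - ξ) ^ (δ - 1) = (K * ((((ξ ^ (μ - 1) : ℝ) : ℂ) * wrightPhi (-(a:ℂ)) μ (-c / ((ξ ^ a : ℝ) : ℂ))) * (((t - ξ) ^ (δ - 1) : ℝ) : ℂ))).re := by
    intro ξ
    rw [hf, ← Complex.re_mul_ofReal, ← mul_assoc K]
    congr 1; ring
  unfold fracJ
  simp only [e]
  rw [h2, mul_left_comm, Complex.re_ofReal_mul, ← mul_assoc, one_div, inv_mul_cancel₀ hG, one_mul]

theorem Gfun_index_relations (α μ : ℝ) (hα0 : 0 < α) (hα1 : α < 1) :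
    ∀ (x : ℝ), x ≠ 0 → ∀ (t : ℝ), 0 < t →
      deriv (deriv (deriv (fun y => Gfun α μ y t))) x = Gfun α (μ - α) x t ∧
      ∀ δ : ℝ, 0 < δ → fracJ δ (fun s => Gfun α μ x s) t = Gfun α (μ + δ) x t := by
  intro x hx t ht
  have hpi := Real.pi_pos
  obtain ⟨θ₀, hθ₀, hθ, hαθ⟩ := exists_theta α hα0 hα1
  have ha : 0 < α / 3 := by positivity
  have ha1 : α / 3 < 1 := by linarith
  have hca : ((α / 3 : ℝ) : ℂ) = (α:ℂ) / 3 := by push_cast; rfl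
  have ht3 : (t ^ (α / 3)) ^ 3 = t ^ α := by
    rw [← Real.rpow_natCast, ← Real.rpow_mul ht.le]; congr 1; push_cast; ring
  have htp : t ^ (μ - α - 1) = t ^ (μ - 1) / (t ^ (α / 3)) ^ 3 := by
    rw [ht3, ← Real.rpow_sub ht]; congr 1; ring
  have htne : t ^ (α / 3) ≠ 0 := by positivity
  have htne' : ((t ^ (α / 3) : ℝ) : ℂ) ≠ 0 := by exact_mod_cast htne
  have hμ3 : μ - 3 * (α / 3) = μ - α := by ring
  have he3 : e23 ^ 3 = 1 := by
    rw [e23, ← Complex.exp_nat_mul, ← Complex.exp_two_pi_mul_I]; congr 1; push_cast; ring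
  rcases lt_or_gt_of_ne hx with hx | hx
  · have hG : ∀ ν s y : ℝ, y < 0 → Gfun α ν y s = (((1/3 : ℝ) : ℂ) * ((s ^ (ν - 1) : ℝ) * wrightPhi (-((α / 3 : ℝ):ℂ)) ν ((y / s ^ (α / 3) : ℝ) : ℂ))).re := by
      intro ν s y hy
      rw [Gfun, if_pos hy, Complex.re_ofReal_mul, Complex.re_ofReal_mul, hca]
      ring
    constructor
    · rw [wre_deriv3 (α / 3) ha ha1 μ (((1/3 : ℝ) : ℂ) * (t ^ (μ - 1) : ℝ)) (1 / ((t ^ (α / 3) : ℝ) : ℂ)) x, hG _ _ _ hx, wre, hμ3, htp]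
      · have e : (1 / ((t ^ (α / 3) : ℝ) : ℂ)) * x = ((x / t ^ (α / 3) : ℝ) : ℂ) := by
          push_cast; ring
        rw [e]
        congr 1
        rw [Complex.ofReal_div (t ^ (μ - 1)), Complex.ofReal_pow]
        generalize wrightPhi _ _ _ = W
        field_simp
      · filter_upwards [Iio_mem_nhds hx] with y hy
        rw [hG _ _ _ hy, wre]
        have e : (1 / ((t ^ (α / 3) : ℝ) : ℂ)) * y = ((y / t ^ (α / 3) : ℝ) : ℂ) := by
          push_cast; ring
        rw [e, mul_assoc]
    · intro δ hδ
      have hc := goodC_of (α / 3) θ₀ ha hαθ (by linarith) (-x) 0 (by linarith) (by rw [abs_zero]; positivity)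
      have hcx : ((-x : ℝ) : ℂ) * Complex.exp ((0:ℝ) * Complex.I) = -(x:ℂ) := by simp
      rw [hcx] at hc
      have ez : ∀ s : ℝ, ((x / s ^ (α / 3) : ℝ) : ℂ) = - -(x:ℂ) / ((s ^ (α / 3) : ℝ) : ℂ) := by
        intro s; push_cast; ring
      rw [wright_J_re (α / 3) θ₀ ha ha1 hθ₀ hθ _ hc μ δ hδ t ht ((1/3 : ℝ) : ℂ), hG _ _ _ hx, ez]
      intro ξ
      rw [hG _ _ _ hx, ez]
  · have hG : ∀ ν s y : ℝ, 0 < y → Gfun α ν y s = ((((-(2/3) : ℝ) : ℂ) * e23) * ((s ^ (ν - 1) : ℝ) * wrightPhi (-((α / 3 : ℝ):ℂ)) ν (e23 * ((y / s ^ (α / 3) : ℝ) : ℂ)))).re := by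
      intro ν s y hy
      rw [Gfun, if_neg (not_lt.mpr hy.le), hca, mul_assoc, mul_assoc ((-(2/3) : ℝ) : ℂ), mul_left_comm e23, Complex.re_ofReal_mul, Complex.re_ofReal_mul]
    constructor
    · rw [wre_deriv3 (α / 3) ha ha1 μ ((((-(2/3) : ℝ) : ℂ) * e23) * (t ^ (μ - 1) : ℝ)) (e23 / ((t ^ (α / 3) : ℝ) : ℂ)) x, hG _ _ _ hx, wre, hμ3, htp]
      · have e : (e23 / ((t ^ (α / 3) : ℝ) : ℂ)) * x = e23 * ((x / t ^ (α / 3) : ℝ) : ℂ) := by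
          push_cast; ring
        rw [e]
        congr 1
        rw [Complex.ofReal_div (t ^ (μ - 1)), Complex.ofReal_pow, div_pow, he3]
        generalize wrightPhi _ _ _ = W
        field_simp
      · filter_upwards [Ioi_mem_nhds hx] with y hy
        rw [hG _ _ _ hy, wre]
        have e : (e23 / ((t ^ (α / 3) : ℝ) : ℂ)) * y = e23 * ((y / t ^ (α / 3) : ℝ) : ℂ) := by
          push_cast; ring
        rw [e, ← mul_assoc]
    · intro δ hδ
      have hc := goodC_of (α / 3) θ₀ ha hαθ (by linarith) x (-(π / 3)) hx (by rw [abs_neg, abs_of_pos (by positivity)])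
      have hcx : (x : ℂ) * Complex.exp ((-(π / 3) : ℝ) * Complex.I) = -(e23 * x) := by
        have : Complex.exp ((-(π / 3) : ℝ) * Complex.I) = -e23 := by
          have h2 : (((-(π / 3) : ℝ) : ℂ) * Complex.I) = 2 * Real.pi * Complex.I / 3 - π * Complex.I := by push_cast; ring
          rw [h2, Complex.exp_sub, Complex.exp_pi_mul_I, e23]; ring
        rw [this]; ring
      rw [hcx] at hc
      have ez : ∀ s : ℝ, e23 * ((x / s ^ (α / 3) : ℝ) : ℂ) = - -(e23 * (x:ℂ)) / ((s ^ (α / 3) : ℝ) : ℂ) := by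
        intro s; push_cast; ring
      rw [wright_J_re (α / 3) θ₀ ha ha1 hθ₀ hθ _ hc μ δ hδ t ht (((-(2/3) : ℝ) : ℂ) * e23), hG _ _ _ hx, ez]
      intro ξ
      rw [hG _ _ _ hx, ez]
end

section
/- Let 0<α<1 and μ∈ℝ, and let θ≥0, with the additional requirement θ≥1 in case −μ is a nonnegative integer. Then there exists a constant C=C(α,μ,θ)>0 such that |G_α^μ(x,t)| ≤ C |x|^{−θ} t^{μ+θα/3−1} for all x≠0 and all t>0. -/
open MeasureTheory Real Filter Set Topology

set_option linter.unusedSimpArgs false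

lemma hk_ev (y ρ c a : ℝ) (hρ : ρ < 1) (hc : 0 < c) :
    ∀ᶠ u : ℝ in atTop, y * rexp (ρ * u) - c * rexp u + a * u ≤ -u := by
  have h1 : Tendsto (fun u : ℝ => rexp ((1 - ρ) * u)) atTop atTop :=
    Real.tendsto_exp_atTop.comp (tendsto_id.const_mul_atTop (by linarith))
  have h2 : Tendsto (fun u : ℝ => rexp u / u) atTop atTop := by
    simpa using Real.tendsto_exp_div_pow_atTop 1
  filter_upwards [h1.eventually_ge_atTop (2 * y / c), h2.eventually_ge_atTop (2 * (a + 1) / c),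
    eventually_gt_atTop 0] with u h3 h4 h5
  have e1 : rexp u = rexp (ρ * u) * rexp ((1 - ρ) * u) := by
    rw [← Real.exp_add]; ring_nf
  have h6 : y * rexp (ρ * u) ≤ c / 2 * rexp u := by
    rw [div_le_iff₀ hc] at h3
    have := mul_le_mul_of_nonneg_left h3 (Real.exp_pos (ρ * u)).le
    rw [e1]; nlinarith
  have h7 : (a + 1) * u ≤ c / 2 * rexp u := by
    rw [div_le_iff₀ hc, div_mul_eq_mul_div, le_div_iff₀ h5] at h4
    linarith
  linarith

lemma hk_int (y ρ c a : ℝ) (hρ : ρ < 1) (hc : 0 < c) :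
    IntegrableOn (fun u : ℝ => rexp (y * rexp (ρ * u) - c * rexp u + a * u)) (Ioi 0) := by
  refine integrable_of_isBigO_exp_neg (b := 1) one_pos (by fun_prop) ?_
  refine Asymptotics.IsBigO.of_bound 1 ?_
  filter_upwards [hk_ev y ρ c a hρ hc] with u hu
  simp only [Real.norm_eq_abs, Real.abs_exp, one_mul]
  exact Real.exp_le_exp.2 (by linarith)

lemma hk_lim (c a : ℝ) (hc : 0 < c) :
    Tendsto (fun u : ℝ => rexp (- c * rexp u + a * u)) atTop (𝓝 0) := by
  refine Real.tendsto_exp_atBot.comp ?_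
  refine tendsto_atBot_mono' _ ?_ tendsto_neg_atTop_atBot
  filter_upwards [hk_ev 0 0 c a one_pos hc] with u hu
  linarith

lemma hk_int0 (c a : ℝ) (hc : 0 < c) :
    IntegrableOn (fun u : ℝ => rexp (- c * rexp u + a * u)) (Ioi 0) := by
  refine (hk_int 0 0 c a one_pos hc).congr_fun (fun u _ => ?_) measurableSet_Ioi
  simp

/-- shift on right half lines -/
lemma hk_shiftR (F : ℂ → ℂ) (hF : Differentiable ℂ F) (a b : ℝ) (B : ℝ → ℝ)
    (hB : IntegrableOn B (Ioi 0)) (hB0 : Tendsto B atTop (𝓝 0))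
    (hFB : ∀ u : ℝ, 0 < u → ∀ v : ℝ, v ∈ uIcc a b → ‖F (u + v * Complex.I)‖ ≤ B u) :
    (∫ u : ℝ in Ioi 0, F (u + a * Complex.I)) - (∫ u : ℝ in Ioi 0, F (u + b * Complex.I))
      = Complex.I * ∫ v : ℝ in a..b, F (v * Complex.I) := by
  have hFc := hF.continuous
  have hi : ∀ v ∈ uIcc a b, IntegrableOn (fun u : ℝ => F (u + v * Complex.I)) (Ioi 0) := by
    intro v hv
    refine Integrable.mono' hB (by fun_prop) ?_
    filter_upwards [ae_restrict_mem measurableSet_Ioi] with u hu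
    exact hFB u hu v hv
  have t1 := intervalIntegral_tendsto_integral_Ioi 0 (hi a left_mem_uIcc) tendsto_id
  have t2 := intervalIntegral_tendsto_integral_Ioi 0 (hi b right_mem_uIcc) tendsto_id
  have t3 : Tendsto (fun R : ℝ => ∫ v : ℝ in a..b, F (R + v * Complex.I)) atTop (𝓝 0) := by
    have : Tendsto (fun R => B R * |b - a|) atTop (𝓝 0) := by simpa using hB0.mul_const |b - a|
    refine squeeze_zero_norm' ?_ this
    filter_upwards [eventually_gt_atTop 0] with R hR
    exact intervalIntegral.norm_integral_le_of_norm_le_const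
      (fun v hv => hFB R hR v (uIoc_subset_uIcc hv))
  have key := fun R : ℝ => Complex.integral_boundary_rect_eq_zero_of_differentiableOn F
    (0 + a * Complex.I) (R + b * Complex.I) hF.differentiableOn
  simp only [Complex.add_re, Complex.zero_re, Complex.mul_re, Complex.ofReal_re, Complex.I_re,
    Complex.ofReal_im, Complex.I_im, Complex.add_im, Complex.zero_im, Complex.mul_im, mul_zero,
    mul_one, sub_zero, zero_add, add_zero, zero_mul, smul_eq_mul, Complex.ofReal_zero] at key
  have t4 := ((t1.sub t2).add (t3.const_mul Complex.I)).sub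
    (tendsto_const_nhds (x := Complex.I * ∫ v : ℝ in a..b, F (v * Complex.I)))
  have := tendsto_nhds_unique t4 (tendsto_const_nhds.congr (fun R => (key R).symm))
  linear_combination this

/-- shift on left half lines -/
lemma hk_shiftL (F : ℂ → ℂ) (hF : Differentiable ℂ F) (a b : ℝ) (B : ℝ → ℝ)
    (hB : IntegrableOn B (Iic 0)) (hB0 : Tendsto B atBot (𝓝 0))
    (hFB : ∀ u : ℝ, u ≤ 0 → ∀ v : ℝ, v ∈ uIcc a b → ‖F (u + v * Complex.I)‖ ≤ B u) :
    (∫ u : ℝ in Iic 0, F (u + b * Complex.I)) - (∫ u : ℝ in Iic 0, F (u + a * Complex.I))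
      = Complex.I * ∫ v : ℝ in a..b, F (v * Complex.I) := by
  have hFc := hF.continuous
  have hi : ∀ v ∈ uIcc a b, IntegrableOn (fun u : ℝ => F (u + v * Complex.I)) (Iic 0) := by
    intro v hv
    refine Integrable.mono' hB (by fun_prop) ?_
    filter_upwards [ae_restrict_mem measurableSet_Iic] with u hu
    exact hFB u hu v hv
  have t1 := intervalIntegral_tendsto_integral_Iic 0 (hi a left_mem_uIcc) tendsto_id
  have t2 := intervalIntegral_tendsto_integral_Iic 0 (hi b right_mem_uIcc) tendsto_id
  have t3 : Tendsto (fun R : ℝ => ∫ v : ℝ in a..b, F (R + v * Complex.I)) atBot (𝓝 0) := by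
    have : Tendsto (fun R => B R * |b - a|) atBot (𝓝 0) := by simpa using hB0.mul_const |b - a|
    refine squeeze_zero_norm' ?_ this
    filter_upwards [eventually_le_atBot 0] with R hR
    exact intervalIntegral.norm_integral_le_of_norm_le_const
      (fun v hv => hFB R hR v (uIoc_subset_uIcc hv))
  have key := fun R : ℝ => Complex.integral_boundary_rect_eq_zero_of_differentiableOn F
    (R + a * Complex.I) (0 + b * Complex.I) hF.differentiableOn
  simp only [Complex.add_re, Complex.zero_re, Complex.mul_re, Complex.ofReal_re, Complex.I_re,
    Complex.ofReal_im, Complex.I_im, Complex.add_im, Complex.zero_im, Complex.mul_im, mul_zero,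
    mul_one, sub_zero, zero_add, add_zero, zero_mul, smul_eq_mul, Complex.ofReal_zero] at key
  have t4 := ((t1.sub t2).sub (t3.const_mul Complex.I)).add
    (tendsto_const_nhds (x := Complex.I * ∫ v : ℝ in a..b, F (v * Complex.I)))
  have := tendsto_nhds_unique t4 ((tendsto_const_nhds (x := (0:ℂ))).congr (fun R => (by
    simp only [id]; linear_combination -(key R))))
  linear_combination -this

noncomputable def hkF (s : ℝ) (w : ℂ) : ℂ := Complex.exp (Complex.exp w + (1 - s) * w)

lemma hkF_diff (s : ℝ) : Differentiable ℂ (hkF s) := by unfold hkF; fun_prop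

lemma hkF_norm (s u v : ℝ) :
    ‖hkF s (u + v * Complex.I)‖ = rexp (Real.cos v * rexp u + (1 - s) * u) := by
  rw [hkF, Complex.norm_exp]
  congr 1
  simp [Complex.exp_re]
  ring

noncomputable def hkH (β : ℝ) (F : ℂ → ℂ) : ℂ :=
  Complex.I * (∫ v : ℝ in (-β)..β, F (v * Complex.I))
    + ((∫ u : ℝ in Ioi 0, F (u + β * Complex.I))
      - ∫ u : ℝ in Ioi 0, F (u + (-β : ℝ) * Complex.I))

lemma hk_Gamma (a : ℝ) (ha : 0 < a) :
    ∫ u : ℝ, rexp (- rexp u + a * u) = Real.Gamma a := by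
  rw [Real.Gamma_eq_integral ha, ← Real.range_exp, ← Set.image_univ,
    integral_image_eq_integral_abs_deriv_smul MeasurableSet.univ
      (fun x _ ↦ (Real.hasDerivAt_exp x).hasDerivWithinAt)
      (fun x _ y _ hxy ↦ Real.exp_injective hxy)]
  simp only [Measure.restrict_univ]
  congr 1; ext u
  rw [abs_of_pos (Real.exp_pos _), ← Real.exp_mul, smul_eq_mul, ← Real.exp_add, ← Real.exp_add]
  ring_nf

lemma hk_cos (β v : ℝ) (hβ : 0 ≤ β) (h1 : β ≤ |v|) (h2 : |v| ≤ π) :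
    Real.cos v ≤ Real.cos β := by
  rw [← Real.cos_abs v]
  exact Real.cos_le_cos_of_nonneg_of_le_pi hβ h2 h1

lemma hkH_shift (s β : ℝ) (hβ : π / 2 < β) (hβ' : β ≤ π) :
    hkH β (hkF s) = hkH π (hkF s) := by
  have hp := Real.pi_pos
  have hc : Real.cos β < 0 := Real.cos_neg_of_pi_div_two_lt_of_lt hβ (by linarith)
  have hb : ∀ u : ℝ, 0 < u → ∀ v : ℝ, β ≤ |v| → |v| ≤ π → ‖hkF s (u + v * Complex.I)‖ ≤
      rexp (-(-Real.cos β) * rexp u + (1 - s) * u) := by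
    intro u _ v h1 h2
    rw [hkF_norm]
    have := hk_cos β v (by linarith) h1 h2
    gcongr
    linarith
  have e1 := hk_shiftR _ (hkF_diff s) β π _ (hk_int0 (-Real.cos β) (1 - s) (by linarith))
    (hk_lim (-Real.cos β) (1 - s) (by linarith)) (by
      intro u hu v hv
      rw [uIcc_of_le hβ'] at hv
      have : |v| = v := abs_of_pos (by linarith [hv.1])
      exact hb u hu v (by linarith [hv.1]) (by linarith [hv.2]))
  have e2 := hk_shiftR _ (hkF_diff s) (-π) (-β) _ (hk_int0 (-Real.cos β) (1 - s) (by linarith))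
    (hk_lim (-Real.cos β) (1 - s) (by linarith)) (by
      intro u hu v hv
      rw [uIcc_of_le (by linarith)] at hv
      have : |v| = -v := abs_of_neg (by linarith [hv.2])
      exact hb u hu v (by linarith [hv.2]) (by linarith [hv.1]))
  have hcont : Continuous (fun v : ℝ => hkF s (v * Complex.I)) := by
    have := (hkF_diff s).continuous
    fun_prop
  have hii := fun a b : ℝ => hcont.intervalIntegrable (μ := volume) a b
  have e3 := intervalIntegral.integral_add_adjacent_intervals (hii (-π) (-β)) (hii (-β) β)
  have e4 := intervalIntegral.integral_add_adjacent_intervals (hii (-π) β) (hii β π)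
  unfold hkH
  rw [← e4, ← e3]
  linear_combination e1 + e2

lemma hkH_lt_one (s : ℝ) (hs : s < 1) :
    hkH π (hkF s) = 2 * π * Complex.I * (Complex.Gamma s)⁻¹ := by
  have hp := Real.pi_pos
  have eL := hk_shiftL _ (hkF_diff s) (-π) π (fun u => rexp 1 * rexp ((1 - s) * u))
    ((integrableOn_exp_mul_Iic (by linarith) 0).const_mul _) (by
      have : Tendsto (fun u : ℝ => rexp ((1 - s) * u)) atBot (𝓝 0) :=
        Real.tendsto_exp_atBot.comp (tendsto_id.const_mul_atBot (by linarith))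
      simpa using this.const_mul (rexp 1)) (by
      intro u hu v _
      rw [hkF_norm, ← Real.exp_add]
      have h1 : rexp u ≤ 1 := Real.exp_le_one_iff.2 hu
      have := Real.cos_le_one v
      have := Real.exp_pos u
      gcongr
      nlinarith)
  have hI : Integrable (fun u : ℝ => rexp (- rexp u + (1 - s) * u)) := by
    rw [← integrableOn_univ, ← Iic_union_Ioi (a := (0:ℝ)), integrableOn_union]
    constructor
    · refine Integrable.mono' (integrableOn_exp_mul_Iic (a := 1 - s) (by linarith) 0)
        (by fun_prop) ?_
      filter_upwards with u
      rw [Real.norm_eq_abs, Real.abs_exp]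
      have := Real.exp_pos u
      gcongr
      linarith
    · simpa using hk_int0 1 (1 - s) one_pos
  have hval : ∀ v : ℝ, Real.cos v = -1 → Real.sin v = 0 → ∀ u : ℝ,
      hkF s (u + v * Complex.I) = Complex.exp ((1 - s) * v * Complex.I) *
        ((rexp (- rexp u + (1 - s) * u) : ℝ) : ℂ) := by
    intro v h1 h2 u
    have hE : Complex.exp (u + v * Complex.I) = - Complex.exp u := by
      rw [Complex.exp_add, Complex.exp_mul_I, ← Complex.ofReal_cos, ← Complex.ofReal_sin, h1, h2]
      simp
    rw [hkF, hE]
    push_cast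
    rw [← Complex.exp_add]
    ring_nf
  have hfull : ∀ v : ℝ, Real.cos v = -1 → Real.sin v = 0 →
      (∫ u : ℝ in Iic 0, hkF s (u + v * Complex.I)) + (∫ u : ℝ in Ioi 0, hkF s (u + v * Complex.I))
        = Complex.exp ((1 - s) * v * Complex.I) * Complex.Gamma (1 - s) := by
    intro v h1 h2
    have hI2 : Integrable (fun u : ℝ => hkF s (u + v * Complex.I)) := by
      simp_rw [hval v h1 h2]
      exact hI.ofReal.const_mul _
    have := integral_add_compl (measurableSet_Iic (a := (0:ℝ))) hI2
    rw [compl_Iic] at this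
    rw [this]
    simp_rw [hval v h1 h2]
    rw [integral_const_mul, integral_complex_ofReal, hk_Gamma _ (by linarith), ← Complex.Gamma_ofReal]
    push_cast; rfl
  have f1 := hfull π (by simp) (by simp)
  have f2 := hfull (-π) (by simp) (by simp)
  have hrefl : Complex.sin (π * s) * Complex.Gamma (1 - s) = π * (Complex.Gamma s)⁻¹ := by
    have h := Complex.Gamma_mul_Gamma_one_sub s
    have hne : Complex.Gamma (1 - s) ≠ 0 :=
      Complex.Gamma_ne_zero_of_re_pos (by simpa using hs)
    by_cases h0 : Complex.sin (π * s) = 0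
    · rw [h0, div_zero] at h
      have : Complex.Gamma s = 0 := by simpa [hne] using h
      simp [h0, this]
    · have hg : Complex.Gamma s ≠ 0 := by
        intro h1
        rw [h1, zero_mul] at h
        have : (π : ℂ) ≠ 0 := by exact_mod_cast hp.ne'
        exact div_ne_zero this h0 h.symm
      rw [eq_div_iff h0] at h
      field_simp
      linear_combination h
  have hsin : Complex.exp ((1 - s) * π * Complex.I) - Complex.exp ((1 - s) * (-π : ℝ) * Complex.I)
      = 2 * Complex.I * Complex.sin (π * s) := by
    have : Complex.sin (π * s) = Complex.sin ((1 - s) * π) := by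
      rw [← Complex.sin_pi_sub]; ring_nf
    rw [this, Complex.sin]
    push_cast
    rw [show (1 - (s:ℂ)) * -π * Complex.I = -((1 - s) * π) * Complex.I by ring]
    linear_combination (Complex.exp ((1 - s) * π * Complex.I) -
      Complex.exp (-((1 - s) * π) * Complex.I)) * Complex.I_sq
  unfold hkH
  rw [← eL]
  linear_combination f1 - f2 + Complex.Gamma (1 - s) * hsin + 2 * Complex.I * hrefl

lemma hkF_intR (s v : ℝ) (hv : Real.cos v < 0) :
    IntegrableOn (fun u : ℝ => hkF s (u + v * Complex.I)) (Ioi 0) := by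
  have := (hkF_diff s).continuous
  refine Integrable.mono' (hk_int0 (-Real.cos v) (1 - s) (by linarith)) (by fun_prop) ?_
  filter_upwards with u
  rw [hkF_norm, neg_neg]

lemma hkF_deriv (s : ℝ) (w : ℂ) :
    HasDerivAt (hkF (s + 1)) (hkF s w - s * hkF (s + 1) w) w := by
  have h1 : HasDerivAt (fun w : ℂ => Complex.exp (Complex.exp w + (1 - (s + 1 : ℝ)) * w))
      (Complex.exp (Complex.exp w + (1 - (s + 1 : ℝ)) * w) *
        (Complex.exp w + (1 - (s + 1 : ℝ)) * 1)) w :=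
    ((Complex.hasDerivAt_exp w).add ((hasDerivAt_id w).const_mul _)).cexp
  refine h1.congr_deriv ?_
  unfold hkF
  have : Complex.exp (Complex.exp w + (1 - s) * w) =
      Complex.exp (Complex.exp w + (1 - (s + 1 : ℝ)) * w) * Complex.exp w := by
    rw [← Complex.exp_add]; push_cast; ring_nf
  rw [this]
  push_cast
  ring

lemma hkH_add_one (s : ℝ) : hkH π (hkF s) = s * hkH π (hkF (s + 1)) := by
  have hR : ∀ v : ℝ, Real.cos v < 0 →
      (∫ u : ℝ in Ioi 0, hkF s (u + v * Complex.I))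
        - s * (∫ u : ℝ in Ioi 0, hkF (s + 1) (u + v * Complex.I))
        = - hkF (s + 1) (v * Complex.I) := by
    intro v hv
    have i1 := hkF_intR s v hv
    have i2 := (hkF_intR (s + 1) v hv).const_mul (s : ℂ)
    rw [← integral_const_mul, ← integral_sub i1 i2]
    have hd : ∀ u : ℝ, HasDerivAt (fun u : ℝ => hkF (s + 1) (u + v * Complex.I))
        (hkF s (u + v * Complex.I) - s * hkF (s + 1) (u + v * Complex.I)) u := by
      intro u
      have h2 : HasDerivAt (fun u : ℝ => (u : ℂ) + v * Complex.I) 1 u :=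
        (Complex.ofRealCLM.hasDerivAt (x := u)).add_const _
      simpa using! (hkF_deriv s (u + v * Complex.I)).comp u h2
    have hl : Tendsto (fun u : ℝ => hkF (s + 1) (u + v * Complex.I)) atTop (𝓝 0) := by
      refine squeeze_zero_norm' (Eventually.of_forall fun u => ?_)
        (hk_lim (-Real.cos v) (1 - (s + 1)) (by linarith))
      rw [hkF_norm, neg_neg]
    have := integral_Ioi_of_hasDerivAt_of_tendsto' (a := 0) (fun u _ => hd u) (i1.sub i2) hl
    simpa using this
  have hV : Complex.I * (∫ v : ℝ in (-π)..π, hkF s (v * Complex.I))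
      - s * (Complex.I * ∫ v : ℝ in (-π)..π, hkF (s + 1) (v * Complex.I))
      = hkF (s + 1) (π * Complex.I) - hkF (s + 1) ((-π : ℝ) * Complex.I) := by
    have hc : ∀ s, Continuous (fun v : ℝ => hkF s (v * Complex.I)) := by
      intro s
      have := (hkF_diff s).continuous
      fun_prop
    have hd : ∀ v : ℝ, HasDerivAt (fun v : ℝ => hkF (s + 1) (v * Complex.I))
        ((hkF s (v * Complex.I) - s * hkF (s + 1) (v * Complex.I)) * Complex.I) v := by
      intro v
      have h2 : HasDerivAt (fun u : ℝ => (u : ℂ) * Complex.I) Complex.I v := by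
        simpa using (Complex.ofRealCLM.hasDerivAt (x := v)).mul_const Complex.I
      have h3 := (hkF_deriv s (v * Complex.I)).comp v h2
      exact h3
    have hc1 := hc s
    have hc2 := hc (s + 1)
    rw [← intervalIntegral.integral_eq_sub_of_hasDerivAt (fun v _ => hd v)
      ((by fun_prop : Continuous _).intervalIntegrable _ _)]
    rw [intervalIntegral.integral_mul_const, intervalIntegral.integral_sub
      (hc1.intervalIntegrable _ _) ((hc2.intervalIntegrable _ _).const_mul _),
      intervalIntegral.integral_const_mul]
    ring
  have r1 := hR π (by simp)
  have r2 := hR (-π) (by simp)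
  unfold hkH
  linear_combination hV + r1 - r2

lemma hkH_tendsto : Tendsto (fun s => hkH π (hkF s)) (𝓝[<] 1) (𝓝 (hkH π (hkF 1))) := by
  have hcs : ∀ w : ℂ, Continuous (fun s => hkF s w) := by
    intro w; unfold hkF; fun_prop
  have hR : ∀ v : ℝ, Real.cos v < 0 →
      Tendsto (fun s => ∫ u : ℝ in Ioi 0, hkF s (u + v * Complex.I)) (𝓝[<] 1)
        (𝓝 (∫ u : ℝ in Ioi 0, hkF 1 (u + v * Complex.I))) := by
    intro v hv
    refine tendsto_integral_filter_of_dominated_convergence _ ?_ ?_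
      (hk_int0 (-Real.cos v) 1 (by linarith)) ?_
    · refine Eventually.of_forall fun s => ?_
      have := (hkF_diff s).continuous
      fun_prop
    · have : ∀ᶠ s : ℝ in 𝓝[<] 1, 0 < s :=
        (eventually_gt_nhds one_pos).filter_mono nhdsWithin_le_nhds
      filter_upwards [this] with s hs
      filter_upwards [ae_restrict_mem measurableSet_Ioi] with u hu
      have hu' : (0:ℝ) < u := hu
      rw [hkF_norm, neg_neg]
      gcongr
      linarith
    · exact Eventually.of_forall fun u => ((hcs _).tendsto 1).mono_left nhdsWithin_le_nhds
  have hV : Continuous (fun s => ∫ v : ℝ in (-π)..π, hkF s (v * Complex.I)) := by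
    refine intervalIntegral.continuous_parametric_intervalIntegral_of_continuous' ?_ _ _
    unfold hkF Function.uncurry
    fun_prop
  unfold hkH
  exact (((hV.tendsto 1).mono_left nhdsWithin_le_nhds).const_mul _).add
    ((hR π (by simp)).sub (hR (-π) (by simp)))

lemma hkH_nat (n : ℕ) : ∀ s : ℝ, s < n + 1 →
    hkH π (hkF s) = 2 * π * Complex.I * (Complex.Gamma s)⁻¹ := by
  induction n with
  | zero => intro s hs; exact hkH_lt_one s (by simpa using hs)
  | succ n ih =>
    intro s hs
    push_cast at hs
    by_cases h1 : s = 1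
    · subst h1
      refine tendsto_nhds_unique hkH_tendsto ?_
      have : Tendsto (fun s : ℝ => 2 * π * Complex.I * (Complex.Gamma s)⁻¹) (𝓝[<] 1)
          (𝓝 (2 * π * Complex.I * (Complex.Gamma (1 : ℝ))⁻¹)) := by
        have hc : Continuous (fun s : ℝ => 2 * π * Complex.I * (Complex.Gamma s)⁻¹) :=
          continuous_const.mul
            (Complex.differentiable_one_div_Gamma.continuous.comp Complex.continuous_ofReal)
        exact (hc.tendsto 1).mono_left nhdsWithin_le_nhds
      refine this.congr' ?_
      filter_upwards [self_mem_nhdsWithin] with s hs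
      exact (hkH_lt_one s hs).symm
    · have h2 := ih (s - 1) (by linarith)
      rw [hkH_add_one, sub_add_cancel] at h2
      have h3 : ((s - 1 : ℝ) : ℂ) ≠ 0 := by
        exact_mod_cast sub_ne_zero.2 h1
      have h4 := Complex.Gamma_add_one _ h3
      rw [show ((s - 1 : ℝ) : ℂ) + 1 = s by push_cast; ring] at h4
      rw [h4, mul_inv]
      apply mul_left_cancel₀ h3
      rw [h2]
      field_simp

lemma hkH_eq (s β : ℝ) (hβ : π / 2 < β) (hβ' : β ≤ π) :
    hkH β (hkF s) = 2 * π * Complex.I * (Complex.Gamma s)⁻¹ := by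
  obtain ⟨n, hn⟩ := exists_nat_gt s
  rw [hkH_shift s β hβ hβ']
  exact hkH_nat n s (by linarith)

noncomputable def hkW (ρ μ : ℝ) (z w : ℂ) : ℂ :=
  Complex.exp (z * Complex.exp (ρ * w)) * hkF μ w

lemma hkW_cont (ρ μ : ℝ) (z : ℂ) : Continuous (hkW ρ μ z) := by
  unfold hkW hkF; fun_prop

lemma hkF_pow (ρ μ : ℝ) (n : ℕ) (w : ℂ) :
    hkF (μ - ρ * n) w = Complex.exp (ρ * w) ^ n * hkF μ w := by
  unfold hkF
  rw [← Complex.exp_nat_mul, ← Complex.exp_add]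
  push_cast
  ring_nf

lemma hkW_hasSum (ρ μ : ℝ) (z w : ℂ) :
    HasSum (fun n : ℕ => z ^ n / n.factorial * hkF (μ - ρ * n) w) (hkW ρ μ z w) := by
  have h := (NormedSpace.expSeries_div_hasSum_exp (z * Complex.exp (ρ * w))).mul_right (hkF μ w)
  rw [← Complex.exp_eq_exp_ℂ] at h
  refine h.congr_fun fun n => ?_
  rw [hkF_pow, mul_pow]
  ring

lemma hk_real_hasSum (y E B : ℝ) :
    HasSum (fun n : ℕ => y ^ n / n.factorial * (E ^ n * B)) (rexp (y * E) * B) := by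
  have h := (NormedSpace.expSeries_div_hasSum_exp (y * E)).mul_right B
  rw [← Real.exp_eq_exp_ℝ] at h
  refine h.congr_fun fun n => ?_
  rw [mul_pow]
  ring

lemma hkF_norm_pow (ρ μ : ℝ) (n : ℕ) (u v : ℝ) :
    ‖hkF (μ - ρ * n) (u + v * Complex.I)‖ =
      rexp (ρ * u) ^ n * rexp (Real.cos v * rexp u + (1 - μ) * u) := by
  rw [hkF_norm, ← Real.exp_nat_mul, ← Real.exp_add]
  ring_nf

lemma hk_norm_term (z : ℂ) (n : ℕ) (x : ℂ) :
    ‖z ^ n / n.factorial * x‖ = ‖z‖ ^ n / n.factorial * ‖x‖ := by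
  simp

lemma hk_sumR (ρ μ : ℝ) (hρ : ρ < 1) (z : ℂ) (v : ℝ) (hv : Real.cos v < 0) :
    HasSum (fun n : ℕ => z ^ n / n.factorial * ∫ u : ℝ in Ioi 0, hkF (μ - ρ * n) (u + v * Complex.I))
      (∫ u : ℝ in Ioi 0, hkW ρ μ z (u + v * Complex.I)) := by
  simp_rw [← integral_const_mul]
  refine hasSum_integral_of_dominated_convergence
    (fun (n : ℕ) (u : ℝ) => ‖z‖ ^ n / n.factorial *
      (rexp (ρ * u) ^ n * rexp (Real.cos v * rexp u + (1 - μ) * u))) ?_ ?_ ?_ ?_ ?_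
  · intro n
    have := (hkF_diff (μ - ρ * n)).continuous
    fun_prop
  · intro n
    filter_upwards with u
    rw [hk_norm_term, hkF_norm_pow]
  · filter_upwards with u
    exact (hk_real_hasSum _ _ _).summable
  · simp_rw [fun u : ℝ => (hk_real_hasSum ‖z‖ (rexp (ρ * u))
      (rexp (Real.cos v * rexp u + (1 - μ) * u))).tsum_eq]
    refine (hk_int ‖z‖ ρ (-Real.cos v) (1 - μ) hρ (by linarith)).congr_fun (fun u _ => ?_)
      measurableSet_Ioi
    simp only
    rw [← Real.exp_add]
    ring_nf
  · filter_upwards with u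
    exact hkW_hasSum _ _ _ _

lemma hk_sumV (ρ μ : ℝ) (z : ℂ) (a b : ℝ) :
    HasSum (fun n : ℕ => z ^ n / n.factorial * ∫ v : ℝ in a..b, hkF (μ - ρ * n) (v * Complex.I))
      (∫ v : ℝ in a..b, hkW ρ μ z (v * Complex.I)) := by
  simp_rw [← intervalIntegral.integral_const_mul]
  refine intervalIntegral.hasSum_integral_of_dominated_convergence
    (fun (n : ℕ) (v : ℝ) => ‖z‖ ^ n / n.factorial * (1 ^ n * rexp 1)) ?_ ?_ ?_ ?_ ?_
  · intro n
    have := (hkF_diff (μ - ρ * n)).continuous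
    fun_prop
  · intro n
    filter_upwards with v _
    rw [hk_norm_term]
    have := hkF_norm_pow ρ μ n 0 v
    simp only [Complex.ofReal_zero, zero_add, mul_zero, Real.exp_zero, mul_one, add_zero] at this
    rw [this]
    have := Real.cos_le_one v
    gcongr
  · filter_upwards with v _
    exact (hk_real_hasSum _ _ _).summable
  · exact intervalIntegrable_const
  · filter_upwards with v _
    exact hkW_hasSum _ _ _ _

lemma hk_wright (ρ μ : ℝ) (hρ : ρ < 1) (z : ℂ) (β : ℝ) (hβ : π / 2 < β) (hβ' : β ≤ π) :
    2 * π * Complex.I * wrightPhi (-ρ) μ z = hkH β (hkW ρ μ z) := by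
  have hp := Real.pi_pos
  have hc : Real.cos β < 0 := Real.cos_neg_of_pi_div_two_lt_of_lt hβ (by linarith)
  have h := ((hk_sumV ρ μ z (-β) β).mul_left Complex.I).add
    ((hk_sumR ρ μ hρ z β hc).sub (hk_sumR ρ μ hρ z (-β) (by simpa using hc)))
  have h2 : HasSum (fun n : ℕ => 2 * π * Complex.I *
      (z ^ n / ((n.factorial : ℂ) * Complex.Gamma (-ρ * n + μ)))) (hkH β (hkW ρ μ z)) := by
    refine h.congr_fun fun n => ?_
    have e := hkH_eq (μ - ρ * n) β hβ hβ'
    rw [show ((μ - ρ * n : ℝ) : ℂ) = -ρ * n + μ by push_cast; ring] at e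
    unfold hkH at e
    rw [div_mul_eq_div_mul_one_div, one_div]
    linear_combination (-z ^ n / n.factorial) * e
  have h3 : (2 * π * Complex.I : ℂ) ≠ 0 := Complex.two_pi_I_ne_zero
  rw [← h2.tsum_eq, tsum_mul_left]
  rfl

lemma hkW_norm (ρ μ : ℝ) (z : ℂ) (δ y u v c : ℝ) (hρ : 0 ≤ ρ) (hu : 0 ≤ u) (hδ : 0 ≤ δ) (hy : 0 ≤ y)
    (hv : Real.cos v ≤ c)
    (hz : (z * Complex.exp (ρ * v * Complex.I)).re ≤ -δ * y) :
    ‖hkW ρ μ z (u + v * Complex.I)‖ ≤ rexp (-δ * y) * rexp (c * rexp u + (1 - μ) * u) := by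
  rw [hkW, norm_mul, hkF_norm, Complex.norm_exp]
  have e : (z * Complex.exp (ρ * (u + v * Complex.I))) =
      ((rexp (ρ * u) : ℝ) : ℂ) * (z * Complex.exp (ρ * v * Complex.I)) := by
    rw [mul_add, Complex.exp_add]
    push_cast
    ring_nf
  rw [e, Complex.re_ofReal_mul]
  have h1 : 1 ≤ rexp (ρ * u) := Real.one_le_exp (by positivity)
  have h2 : 0 ≤ δ * y := by positivity
  have h3 : rexp (ρ * u) * (z * Complex.exp (ρ * v * Complex.I)).re ≤ -δ * y := by
    nlinarith
  gcongr

lemma hk_bound (ρ μ β δ : ℝ) (hρ0 : 0 ≤ ρ) (hρ : ρ < 1) (hβ : π / 2 < β) (hβ' : β ≤ π)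
    (hδ : 0 ≤ δ) : ∃ K > 0, ∀ y : ℝ, 0 ≤ y → ∀ z : ℂ,
      (∀ v : ℝ, |v| ≤ β → (z * Complex.exp (ρ * v * Complex.I)).re ≤ -δ * y) →
      ‖wrightPhi (-ρ) μ z‖ ≤ K * rexp (-δ * y) := by
  have hp := Real.pi_pos
  have hc : Real.cos β < 0 := Real.cos_neg_of_pi_div_two_lt_of_lt hβ (by linarith)
  set J : ℝ := ∫ u : ℝ in Ioi 0, rexp (-(-Real.cos β) * rexp u + (1 - μ) * u) with hJ
  have hJ0 : 0 ≤ J := integral_nonneg fun u => (Real.exp_pos _).le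
  have hJi := hk_int0 (-Real.cos β) (1 - μ) (by linarith)
  refine ⟨(rexp 1 * |β - -β| + (J + J)) / (2 * π) + 1, by positivity, ?_⟩
  intro y hy z hz
  have hw := hk_wright ρ μ hρ z β hβ hβ'
  have hR : ∀ v : ℝ, |v| = β →
      ‖∫ u : ℝ in Ioi 0, hkW ρ μ z (u + v * Complex.I)‖ ≤ rexp (-δ * y) * J := by
    intro v hv
    rw [hJ, ← integral_const_mul]
    refine norm_integral_le_of_norm_le (hJi.const_mul _) ?_
    filter_upwards [ae_restrict_mem measurableSet_Ioi] with u hu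
    have hu' : (0:ℝ) < u := hu
    refine hkW_norm ρ μ z δ y u v _ hρ0 hu'.le hδ hy ?_ (hz v hv.le)
    rw [neg_neg, ← hv, Real.cos_abs]
  have hV : ‖∫ v : ℝ in (-β)..β, hkW ρ μ z (v * Complex.I)‖ ≤
      rexp (-δ * y) * rexp 1 * |β - -β| := by
    refine intervalIntegral.norm_integral_le_of_norm_le_const fun v hv => ?_
    rw [uIoc_of_le (by linarith)] at hv
    have := hkW_norm ρ μ z δ y 0 v 1 hρ0 le_rfl hδ hy (Real.cos_le_one v)
      (hz v (abs_le.2 ⟨hv.1.le, hv.2⟩))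
    simpa using this
  have hH : ‖hkH β (hkW ρ μ z)‖ ≤ rexp (-δ * y) * rexp 1 * |β - -β| +
      (rexp (-δ * y) * J + rexp (-δ * y) * J) := by
    unfold hkH
    refine (norm_add_le _ _).trans (add_le_add ?_ ((norm_sub_le _ _).trans (add_le_add ?_ ?_)))
    · rw [norm_mul, Complex.norm_I, one_mul]; exact hV
    · exact hR β (abs_of_pos (by linarith))
    · exact hR (-β) (by rw [abs_neg]; exact abs_of_pos (by linarith))
  have hn : ‖(2 * π * Complex.I * wrightPhi (-ρ) μ z : ℂ)‖ = 2 * π * ‖wrightPhi (-ρ) μ z‖ := by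
    simp [abs_of_pos hp]
  rw [← hw, hn] at hH
  have h5 : ‖wrightPhi (-ρ) μ z‖ ≤ (rexp 1 * |β - -β| + (J + J)) / (2 * π) * rexp (-δ * y) := by
    rw [div_mul_eq_mul_div, le_div_iff₀ (by positivity)]
    linarith
  have := Real.exp_pos (-δ * y)
  linarith

lemma hk_decay (δ θ : ℝ) (hδ : 0 < δ) (hθ : 0 ≤ θ) :
    ∃ C > 0, ∀ y : ℝ, 0 < y → rexp (-δ * y) ≤ C * y ^ (-θ) := by
  obtain ⟨m, hm⟩ := exists_nat_ge θ
  refine ⟨1 + m.factorial / δ ^ m, by positivity, fun y hy => ?_⟩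
  have h1 : y ^ θ ≤ 1 + y ^ m := by
    rcases le_total y 1 with h | h
    · have := Real.rpow_le_one hy.le h hθ
      have : 0 < y ^ m := by positivity
      linarith
    · have := Real.rpow_le_rpow_of_exponent_le h hm
      rw [Real.rpow_natCast] at this
      linarith
  have h2 := Real.pow_div_factorial_le_exp (δ * y) (by positivity) m
  have h3 : y ^ m ≤ m.factorial / δ ^ m * rexp (δ * y) := by
    rw [mul_pow, div_le_iff₀ (by positivity)] at h2
    rw [div_mul_eq_mul_div, le_div_iff₀ (by positivity)]
    linarith
  have h4 : 1 ≤ rexp (δ * y) := Real.one_le_exp (by positivity)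
  rw [Real.rpow_neg hy.le, ← div_eq_mul_inv, le_div_iff₀ (by positivity), neg_mul, Real.exp_neg,
    inv_mul_le_iff₀ (Real.exp_pos _)]
  nlinarith

theorem Gfun_estimate (α μ θ : ℝ) (hα0 : 0 < α) (hα1 : α < 1) (hθ : 0 ≤ θ)
    (hθ' : (∃ n : ℕ, μ = -(n : ℝ)) → 1 ≤ θ) :
    ∃ C > 0, ∀ (x : ℝ), x ≠ 0 → ∀ (t : ℝ), 0 < t →
      |Gfun α μ x t| ≤ C * |x| ^ (-θ) * t ^ (μ + θ * α / 3 - 1) := by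
  have hp := Real.pi_pos
  set β : ℝ := π / 2 * (2 - α) with hβd
  set γ : ℝ := α / 3 * β with hγ
  have hβ : π / 2 < β := by rw [hβd]; nlinarith
  have hβ' : β ≤ π := by rw [hβd]; nlinarith
  have hγ0 : 0 ≤ γ := by rw [hγ]; exact mul_nonneg (by linarith) (by linarith)
  have hγ1 : γ < π / 6 := by
    have : γ = π / 6 * (1 - (1 - α) ^ 2) := by rw [hγ, hβd]; ring
    rw [this]
    have : 0 < π * (1 - α) ^ 2 := by
      have : 0 < 1 - α := by linarith
      positivity
    linarith
  set δ : ℝ := Real.cos (π / 3 + γ) with hδd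
  have hδ : 0 < δ := Real.cos_pos_of_mem_Ioo ⟨by linarith, by linarith⟩
  obtain ⟨K, hK, hb⟩ := hk_bound (α / 3) μ β δ (by positivity) (by linarith) hβ hβ' hδ.le
  obtain ⟨C, hC, hd⟩ := hk_decay δ θ hδ hθ
  have hvγ : ∀ v : ℝ, |v| ≤ β → |α / 3 * v| ≤ γ := by
    intro v hv
    rw [abs_mul, abs_of_pos (by positivity : 0 < α / 3), hγ]
    gcongr
  have hz1 : ∀ y : ℝ, 0 ≤ y → ‖wrightPhi (-(α / 3 : ℝ)) μ ((-y : ℝ) : ℂ)‖ ≤ K * rexp (-δ * y) := by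
    intro y hy
    refine hb y hy _ fun v hv => ?_
    have h1 := hvγ v hv
    rw [show ((α / 3 : ℝ) : ℂ) * v = ((α / 3 * v : ℝ) : ℂ) by push_cast; ring,
      Complex.re_ofReal_mul, Complex.exp_ofReal_mul_I_re]
    have : δ ≤ Real.cos (α / 3 * v) := by
      rw [← Real.cos_abs (α / 3 * v)]
      exact Real.cos_le_cos_of_nonneg_of_le_pi (abs_nonneg _) (by linarith) (by linarith)
    nlinarith
  have hz2 : ∀ y : ℝ, 0 ≤ y → ‖wrightPhi (-(α / 3 : ℝ)) μ (e23 * y)‖ ≤ K * rexp (-δ * y) := by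
    intro y hy
    refine hb y hy _ fun v hv => ?_
    have h1 := abs_le.1 (hvγ v hv)
    have e : e23 * y * Complex.exp ((α / 3 : ℝ) * v * Complex.I) =
        (y : ℂ) * Complex.exp ((π - (π / 3 - α / 3 * v) : ℝ) * Complex.I) := by
      rw [e23, mul_comm _ (y : ℂ), mul_assoc, ← Complex.exp_add]
      push_cast
      ring_nf
    rw [e, Complex.re_ofReal_mul, Complex.exp_ofReal_mul_I_re, Real.cos_pi_sub]
    have : δ ≤ Real.cos (π / 3 - α / 3 * v) := by
      rw [← Real.cos_abs (π / 3 - α / 3 * v)]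
      exact Real.cos_le_cos_of_nonneg_of_le_pi (abs_nonneg _) (by linarith)
        (abs_le.2 ⟨by linarith, by linarith⟩)
    nlinarith
  refine ⟨K * C, by positivity, fun x hx t ht => ?_⟩
  set y : ℝ := |x| / t ^ (α / 3) with hyd
  have hta : 0 < t ^ (α / 3) := Real.rpow_pos_of_pos ht _
  have hx0 : 0 < |x| := abs_pos.2 hx
  have hy : 0 < y := by positivity
  have htm : 0 < t ^ (μ - 1) := Real.rpow_pos_of_pos ht _
  have main : |Gfun α μ x t| ≤ t ^ (μ - 1) * (K * rexp (-δ * y)) := by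
    have hpos : 0 ≤ K * rexp (-δ * y) := by positivity
    unfold Gfun
    split_ifs with h
    · have h1 := hz1 y hy.le
      rw [show -y = x / t ^ (α / 3) by rw [hyd, abs_of_neg h]; ring] at h1
      push_cast at h1
      have h2 := (Complex.abs_re_le_norm _).trans h1
      push_cast
      rw [abs_mul, abs_of_pos (by positivity : 0 < 1 / 3 * t ^ (μ - 1))]
      calc _ ≤ 1 / 3 * t ^ (μ - 1) * (K * rexp (-δ * y)) := by gcongr
        _ ≤ _ := by nlinarith [mul_nonneg htm.le hpos]
    · have h1 := hz2 y hy.le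
      rw [show y = x / t ^ (α / 3) by rw [hyd, abs_of_nonneg (not_lt.1 h)]] at h1
      have hn : ‖e23‖ = 1 := by
        rw [e23, show (2 * π * Complex.I / 3 : ℂ) = (2 * π / 3 : ℝ) * Complex.I by push_cast; ring]
        exact Complex.norm_exp_ofReal_mul_I _
      have h2 := (Complex.abs_re_le_norm (e23 * wrightPhi (-(α / 3 : ℝ)) μ
        (e23 * (x / t ^ (α / 3) : ℝ))))
      rw [norm_mul, hn, one_mul] at h2
      replace h2 := h2.trans h1
      rw [show x / t ^ (α / 3) = y by rw [hyd, abs_of_nonneg (not_lt.1 h)]] at h2 ⊢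
      push_cast at h2 ⊢
      rw [abs_mul, abs_mul, abs_of_pos htm, abs_neg, abs_of_pos (by norm_num : (0:ℝ) < 2 / 3)]
      calc _ ≤ 2 / 3 * t ^ (μ - 1) * (K * rexp (-δ * y)) := by gcongr
        _ ≤ _ := by nlinarith [mul_nonneg htm.le hpos]
  refine main.trans ?_
  have e1 : t ^ (μ + θ * α / 3 - 1) = t ^ (μ - 1) * (t ^ (α / 3)) ^ θ := by
    rw [← Real.rpow_mul ht.le, ← Real.rpow_add ht]
    ring_nf
  have e2 : y ^ (-θ) = |x| ^ (-θ) * (t ^ (α / 3)) ^ θ := by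
    rw [hyd, Real.div_rpow hx0.le hta.le, Real.rpow_neg hta.le, div_inv_eq_mul]
  have := hd y hy
  rw [e2] at this
  rw [e1]
  calc _ ≤ t ^ (μ - 1) * (K * (C * (|x| ^ (-θ) * (t ^ (α / 3)) ^ θ))) := by gcongr
    _ = _ := by ring
end
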